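/- arXiv:2407.03366 — 3 statements merged into one kernel-verified Lean document; each statement's English description precedes it below -/
import Mathlib

section
/- Let n ≥ 2, ρ = (n−1)/2, and let λ be either purely imaginary with nonnegative imaginary part or real with 0 < λ < ρ. The boundary values F_λ(x ± i0) exist on (1,∞): there exist continuous functions b⁺, b⁻ : (1,∞) → ℂ such that, as ε → 0⁺, the functions x ↦ F_λ(x + iε) converge to b⁺ and the functions x ↦ F_λ(x − iε) converge to b⁻, uniformly on every compact subset of (1,∞). -/
open scoped BigOperators
open Filter Topology

noncomputable section

/-- The Lorentzian bilinear form on `ℝ^{1+n}`. -/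
def lformR (n : ℕ) (x y : Fin (n+1) → ℝ) : ℝ :=
  ∑ i, (if i = 0 then (-1 : ℝ) else 1) * x i * y i

/-- The complex-bilinear Lorentzian form on `ℂ^{1+n}`. -/
def lformC (n : ℕ) (z w : Fin (n+1) → ℂ) : ℂ :=
  ∑ i, (if i = 0 then (-1 : ℂ) else 1) * z i * w i

/-- The matrix `η = diag(−1,1,…,1)`. -/
def eta (n : ℕ) : Matrix (Fin (n+1)) (Fin (n+1)) ℝ :=
  Matrix.diagonal (fun i => if i = 0 then (-1 : ℝ) else 1)

/-- Membership in `G = SO(1,n)_e`. -/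
def memG (n : ℕ) (g : Matrix (Fin (n+1)) (Fin (n+1)) ℝ) : Prop :=
  g.transpose * eta n * g = eta n ∧ g.det = 1 ∧ 0 < g 0 0

/-- Standard basis vector `e₀`. -/
def e0 (n : ℕ) : Fin (n+1) → ℝ := fun i => if i = 0 then 1 else 0

/-- Standard basis vector `eₙ`. -/
def elast (n : ℕ) : Fin (n+1) → ℝ := fun i => if i = Fin.last n then 1 else 0

/-- Membership in `H = SO(1,n−1)_e`, the stabilizer of `eₙ`. -/
def memH (n : ℕ) (g : Matrix (Fin (n+1)) (Fin (n+1)) ℝ) : Prop :=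
  memG n g ∧ g.mulVec (elast n) = elast n

/-- Membership in `K = SO(n)`, the stabilizer of `e₀`. -/
def memK (n : ℕ) (g : Matrix (Fin (n+1)) (Fin (n+1)) ℝ) : Prop :=
  memG n g ∧ g.mulVec (e0 n) = e0 n

/-- The boost `a_t`. -/
def boost (n : ℕ) (t : ℝ) : Matrix (Fin (n+1)) (Fin (n+1)) ℝ :=
  Matrix.of fun i j =>
    if i = 0 ∧ j = 0 then Real.cosh t
    else if i = Fin.last n ∧ j = Fin.last n then Real.cosh t
    else if (i = 0 ∧ j = Fin.last n) ∨ (i = Fin.last n ∧ j = 0) then Real.sinh t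
    else if i = j then 1 else 0

/-- The upper hemisphere `S^n_+ = {(ix₀, 𝐱) : x₀ > 0, x₀² + |𝐱|² = 1}` in `ℂ^{1+n}`. -/
def Snplus (n : ℕ) : Set (Fin (n+1) → ℂ) :=
  {z | ∃ x : Fin (n+1) → ℝ, 0 < x 0 ∧ (∑ i, (x i)^2) = 1 ∧
    z 0 = Complex.I * (x 0 : ℂ) ∧ ∀ i, i ≠ 0 → z i = (x i : ℂ)}

/-- The crown domain `Ξ = G · S^n_+ ⊂ ℂ^{1+n}`. -/
def Xi (n : ℕ) : Set (Fin (n+1) → ℂ) :=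
  {z | ∃ g w, memG n g ∧ w ∈ Snplus n ∧ z = (g.map (Complex.ofReal)).mulVec w}

/-- The conjugate crown `Ξ̄`. -/
def XiBar (n : ℕ) : Set (Fin (n+1) → ℂ) :=
  {z | (fun i => (starRingEnd ℂ) (z i)) ∈ Xi n}

/-- The de Sitter space `dS^n` viewed inside `ℂ^{1+n}`. -/
def dSC (n : ℕ) : Set (Fin (n+1) → ℂ) :=
  {z | (∀ i, (z i).im = 0) ∧ lformC n z z = 1}

/-- The cut `[1,∞) ⊂ ℂ`. -/
def slit : Set ℂ := {z | z.im = 0 ∧ 1 ≤ z.re}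

/-- Componentwise complex conjugation on `ℂ^{1+n}`. -/
def conjVec (n : ℕ) (z : Fin (n+1) → ℂ) : Fin (n+1) → ℂ :=
  fun i => (starRingEnd ℂ) (z i)

/-- `λ` is admissible: purely imaginary with nonnegative imaginary part, or
real with `0 < λ < ρ = (n−1)/2`. -/
def admissible (n : ℕ) (lam : ℂ) : Prop :=
  (lam.re = 0 ∧ 0 ≤ lam.im) ∨ (lam.im = 0 ∧ 0 < lam.re ∧ lam.re < ((n : ℝ) - 1)/2)

/-- Euler's integral representation of `₂F₁(ρ+λ, ρ−λ; n/2; ·)` on `ℂ∖[1,∞)`,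
with `ρ = (n−1)/2`. -/
def Flam (n : ℕ) (lam : ℂ) (z : ℂ) : ℂ :=
  (Complex.Gamma ((n : ℂ)/2) /
    (Complex.Gamma (((n : ℂ) - 1)/2 - lam) * Complex.Gamma (1/2 + lam))) *
  ∫ t in (0:ℝ)..1, (t : ℂ) ^ (((n : ℂ) - 1)/2 - lam - 1) *
    ((1 : ℂ) - (t : ℂ)) ^ (lam - 1/2) *
    ((1 : ℂ) - z * (t : ℂ)) ^ (-(((n : ℂ) - 1)/2) - lam)

/-- General term of the Gauss hypergeometric series `₂F₁(a,b;c;w)`. -/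
def hypTerm (a b c : ℂ) (w : ℂ) (k : ℕ) : ℂ :=
  (ascPochhammer ℂ k).eval a * (ascPochhammer ℂ k).eval b /
    ((ascPochhammer ℂ k).eval c * (k.factorial : ℂ)) * w ^ k

/-- The curve `z_t = (i cos t, 0, …, 0, sin t)` in the crown `Ξ`. -/
def zCurve (n : ℕ) (t : ℝ) : Fin (n+1) → ℂ :=
  fun i => if i = 0 then Complex.I * (Real.cos t : ℂ)
    else if i = Fin.last n then (Real.sin t : ℂ) else 0

/-- The curve `z̃_t = (−i cos t, 0, …, 0, sin t)` in the conjugate crown `Ξ̄`. -/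
def zCurveBar (n : ℕ) (t : ℝ) : Fin (n+1) → ℂ :=
  fun i => if i = 0 then -Complex.I * (Real.cos t : ℂ)
    else if i = Fin.last n then (Real.sin t : ℂ) else 0

/-- The open future cone `Γ⁺(eₙ)` in `dS^n`. -/
def futureCone (n : ℕ) : Set (Fin (n+1) → ℝ) :=
  {y | lformR n y y = 1 ∧ lformR n (y - elast n) (y - elast n) < 0 ∧ 0 < y 0}

/-- The open past cone `Γ⁻(eₙ)` in `dS^n`. -/
def pastCone (n : ℕ) : Set (Fin (n+1) → ℝ) :=
  {y | lformR n y y = 1 ∧ lformR n (y - elast n) (y - elast n) < 0 ∧ y 0 < 0}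


/-- The boundary value expression in Statement 12 (sign `s = ∓1` for `x ± i0`). -/
def bval (n : ℕ) (lam : ℂ) (x : ℝ) (s : ℝ) : ℂ :=
  (Complex.Gamma ((n : ℂ)/2) * Complex.Gamma ((2 - (n : ℂ))/2) /
      (Complex.Gamma (1/2 + lam) * Complex.Gamma (1/2 - lam))) *
    ∑' k : ℕ, hypTerm (((n : ℂ) - 1)/2 + lam) (((n : ℂ) - 1)/2 - lam) ((n : ℂ)/2)
      ((1 : ℂ) - x) k
  + Complex.exp ((s : ℂ) * (Real.pi : ℂ) * Complex.I * ((2 - (n : ℂ))/2)) *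
      (((x - 1) ^ ((2 - (n : ℝ))/2) : ℝ) : ℂ) *
      (Complex.Gamma ((n : ℂ)/2) * Complex.Gamma (((n : ℂ) - 2)/2) /
        (Complex.Gamma (((n : ℂ) - 1)/2 + lam) * Complex.Gamma (((n : ℂ) - 1)/2 - lam))) *
    ∑' k : ℕ, hypTerm (1/2 - lam) (1/2 + lam) ((4 - (n : ℂ))/2) ((1 : ℂ) - x) k

end

open Set MeasureTheory in
/-- If `g` is integrable and `P` is jointly continuous, then `∫ g t * P z t dt` is continuous
in the parameter `z`. -/
theorem continuousOn_intervalIntegral_mul {X : Type*} [TopologicalSpace X] [FirstCountableTopology X]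
    {V : Set X} {p q : ℝ} {g : ℝ → ℂ} {P : X → ℝ → ℂ}
    (hg : IntervalIntegrable g volume p q) (hP : ContinuousOn ↿P (V ×ˢ uIcc p q)) :
    ContinuousOn (fun z => ∫ t in p..q, g t * P z t) V := by
  have hPz : ∀ z ∈ V, ContinuousOn (P z) (uIcc p q) := fun z hz =>
    hP.comp (f := fun t => (z, t)) (by fun_prop) fun t ht => ⟨hz, ht⟩
  have hint : ∀ z ∈ V, IntervalIntegrable (fun t => g t * P z t) volume p q := fun z hz =>
    hg.mul_continuousOn (hPz z hz)
  intro z hz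
  obtain ⟨v, hv, hvP⟩ := isCompact_uIcc.mem_uniformity_of_prod hP hz
    (Metric.dist_mem_uniformity one_pos)
  obtain ⟨M, hM⟩ := isCompact_uIcc.exists_bound_of_continuousOn (hPz z hz)
  refine intervalIntegral.continuousWithinAt_of_dominated_interval
    (bound := fun t => ‖g t‖ * (M + 1)) ?_ ?_ (hg.norm.mul_const _) ?_
  · filter_upwards [self_mem_nhdsWithin] with w hw
    exact (intervalIntegrable_iff.1 (hint w hw)).aestronglyMeasurable
  · filter_upwards [hv] with w hw
    refine ae_of_all _ fun t ht => ?_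
    have ht' := uIoc_subset_uIcc ht
    have h1 := hvP w hw t ht'
    have h2 := hM t ht'
    rw [norm_mul]
    gcongr
    have h3 : ‖P w t - P z t‖ < 1 := by simpa [dist_eq_norm] using h1
    linarith [norm_le_norm_add_norm_sub' (P w t) (P z t)]
  · refine ae_of_all _ fun t ht => ?_
    refine ContinuousWithinAt.mul continuousWithinAt_const ?_
    exact (hP (z, t) ⟨hz, uIoc_subset_uIcc ht⟩).comp (f := fun w => (w, t))
      (by fun_prop) fun w hw => ⟨hw, uIoc_subset_uIcc ht⟩

/-- The branch of `(1 - u) ^ γ` that is continuous on the closed upper half-plane minus `1`. -/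
noncomputable def upperPow (γ u : ℂ) : ℂ :=
  (Complex.I * (1 - u)) ^ γ * Complex.exp (-(Complex.log Complex.I * γ))

theorem upperPow_eq {γ u : ℂ} (hu : 0 < u.im ∨ u = 0) : upperPow γ u = (1 - u) ^ γ := by
  rcases hu with hu | rfl
  · have h1 : (1 - u) ≠ 0 := fun h => by
      have := congrArg Complex.im h
      simp at this; linarith
    have harg : (1 - u).arg < 0 := by simpa using hu
    have hpi := Complex.neg_pi_lt_arg (1 - u)
    rw [upperPow, Complex.cpow_def_of_ne_zero (mul_ne_zero Complex.I_ne_zero h1),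
      Complex.cpow_def_of_ne_zero h1, Complex.log_mul Complex.I_ne_zero h1, ← Complex.exp_add]
    · ring_nf
    · rw [Complex.arg_I]
      constructor <;> linarith [Real.pi_pos]
  · rw [upperPow, sub_zero, mul_one, Complex.one_cpow,
      Complex.cpow_def_of_ne_zero Complex.I_ne_zero, ← Complex.exp_add]
    simp

theorem continuousOn_upperPow (γ : ℂ) :
    ContinuousOn (upperPow γ) {u | 0 ≤ u.im ∧ u ≠ 1} := by
  intro u ⟨hu, hu1⟩
  refine ContinuousAt.continuousWithinAt ?_
  refine ContinuousAt.mul (ContinuousAt.cpow (by fun_prop) continuousAt_const ?_) continuousAt_const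
  rw [Complex.mem_slitPlane_iff]
  rcases hu.lt_or_eq with h | h
  · left; simpa using h
  · right
    intro h0
    apply hu1
    apply Complex.ext
    · simp at h0 ⊢; linarith
    · simpa using h.symm

/-- The weight `t ^ α * (1 - t) ^ β` of the Euler integral. -/
noncomputable def eulerWeight (α β t : ℂ) : ℂ := t ^ α * (1 - t) ^ β

theorem differentiableAt_eulerWeight {α β t : ℂ} (h0 : 0 < t.re) (h1 : t.re < 1) :
    DifferentiableAt ℂ (eulerWeight α β) t := by
  unfold eulerWeight
  refine (DifferentiableAt.cpow_const (by fun_prop) ?_).mul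
    (DifferentiableAt.cpow_const (by fun_prop) ?_)
  · exact Or.inl h0
  · left; simpa using h1

open MeasureTheory in
theorem intervalIntegrable_eulerWeight {α β : ℂ} (hα : -1 < α.re) (hβ : -1 < β.re) :
    IntervalIntegrable (fun t : ℝ => eulerWeight α β t) volume 0 1 := by
  have := Complex.betaIntegral_convergent (u := α + 1) (v := β + 1)
    (by simp; linarith) (by simp; linarith)
  simpa [eulerWeight] using this

/-- Euler's integral without its normalising constant. -/
noncomputable def eulerIntegral (α β γ z : ℂ) : ℂ :=
  ∫ t in (0 : ℝ)..1, eulerWeight α β t * (1 - z * t) ^ γ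

open Set MeasureTheory in
theorem continuousOn_pathIntegral {α β γ : ℂ} {p q : ℝ} {φ : ℝ → ℂ} {V : Set ℂ}
    (hφ : Continuous φ)
    (hw : IntervalIntegrable (fun t => eulerWeight α β (φ t)) volume p q)
    (hV : ∀ z ∈ V, ∀ t ∈ uIcc p q, 0 ≤ (z * φ t).im ∧ z * φ t ≠ 1) :
    ContinuousOn (fun z => ∫ t in p..q, eulerWeight α β (φ t) * upperPow γ (z * φ t)) V := by
  refine continuousOn_intervalIntegral_mul (P := fun z t => upperPow γ (z * φ t)) hw ?_
  refine (continuousOn_upperPow γ).comp (f := fun x : ℂ × ℝ => x.1 * φ x.2) (by fun_prop) ?_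
  rintro ⟨z, t⟩ ⟨hz, ht⟩
  exact hV z hz t ht

theorem eulerIntegral_eq_upperPow {α β γ z : ℂ} (hz : 0 < z.im) :
    eulerIntegral α β γ z =
      ∫ t in (0 : ℝ)..1, eulerWeight α β t * upperPow γ (z * t) := by
  refine intervalIntegral.integral_congr fun t ht => ?_
  rw [Set.uIcc_of_le zero_le_one] at ht
  rw [upperPow_eq]
  rcases ht.1.eq_or_lt with h | h
  · right; simp [← h]
  · left; simpa using mul_pos hz h

open Complex in
/-- Cauchy's theorem: the middle part of the path is pushed into the upper half-plane. -/
theorem integral_eulerWeight_mul_upperPow_deform {α β γ z : ℂ} {a b : ℝ} (ha : 0 < a)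
    (hab : a ≤ b) (hb : b < 1) (hz : 0 < z.im) (hz' : 0 < z.re) :
    ∫ t in a..b, eulerWeight α β t * upperPow γ (z * t) =
      (∫ t in a..b, eulerWeight α β (t + I) * upperPow γ (z * (t + I))) -
      I * (∫ y in (0 : ℝ)..1, eulerWeight α β (b + y * I) * upperPow γ (z * (b + y * I))) +
      I * ∫ y in (0 : ℝ)..1, eulerWeight α β (a + y * I) * upperPow γ (z * (a + y * I)) := by
  have key := integral_boundary_rect_eq_zero_of_differentiableOn
    (fun t => eulerWeight α β t * upperPow γ (z * t)) a (b + I) ?_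
  · simp at key
    linear_combination key
  · intro t ht
    simp [mem_reProdIm, Set.uIcc_of_le hab] at ht
    obtain ⟨⟨h1, h2⟩, h3, -⟩ := ht
    refine DifferentiableAt.differentiableWithinAt ?_
    refine (differentiableAt_eulerWeight (by linarith) (by linarith)).mul ?_
    unfold upperPow
    refine DifferentiableAt.mul_const (DifferentiableAt.cpow_const (by fun_prop) ?_) _
    left
    have : 0 < z.im * t.re := mul_pos hz (by linarith)
    have : 0 ≤ z.re * t.im := by positivity
    simp
    linarith

open Complex Set MeasureTheory in
theorem exists_continuousOn_eq_eulerIntegral {α β γ : ℂ} (hα : -1 < α.re) (hβ : -1 < β.re)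
    {a b : ℝ} (ha : 0 < a) (hab : a ≤ b) (hb : b < 1) :
    ∃ G : ℂ → ℂ, ContinuousOn G {z | 0 ≤ z.im ∧ a * z.re < 1 ∧ 1 < b * z.re} ∧
      ∀ z, 0 < z.im → 0 < z.re → G z = eulerIntegral α β γ z := by
  have hw := intervalIntegrable_eulerWeight hα hβ
  have hb0 : 0 < b := ha.trans_le hab
  have hw1 : IntervalIntegrable (fun t : ℝ => eulerWeight α β t) volume 0 a :=
    hw.mono_set (by
      rw [uIcc_of_le ha.le, uIcc_of_le zero_le_one]
      exact Icc_subset_Icc_right (by linarith))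
  have hw2 : IntervalIntegrable (fun t : ℝ => eulerWeight α β t) volume a b :=
    hw.mono_set (by
      rw [uIcc_of_le hab, uIcc_of_le zero_le_one]
      exact Icc_subset_Icc ha.le hb.le)
  have hw3 : IntervalIntegrable (fun t : ℝ => eulerWeight α β t) volume b 1 :=
    hw.mono_set (by
      rw [uIcc_of_le hb.le, uIcc_of_le zero_le_one]
      exact Icc_subset_Icc_left hb0.le)
  have hre : ∀ z : ℂ, 1 < b * z.re → 0 < z.re := fun z h =>
    (mul_pos_iff_of_pos_left hb0).1 (by linarith)
  have hwc : ∀ (φ : ℝ → ℂ) (p q : ℝ), Continuous φ →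
      (∀ t ∈ uIcc p q, 0 < (φ t).re ∧ (φ t).re < 1) →
      IntervalIntegrable (fun t => eulerWeight α β (φ t)) volume p q := fun φ p q hφ h =>
    ContinuousOn.intervalIntegrable fun t ht =>
      ((differentiableAt_eulerWeight (h t ht).1 (h t ht).2).continuousAt.comp
        hφ.continuousAt).continuousWithinAt
  refine ⟨fun z => (∫ t in (0 : ℝ)..a, eulerWeight α β t * upperPow γ (z * t)) +
      ((∫ t in a..b, eulerWeight α β (t + I) * upperPow γ (z * (t + I))) -
      I * (∫ y in (0 : ℝ)..1, eulerWeight α β (b + y * I) * upperPow γ (z * (b + y * I))) +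
      I * ∫ y in (0 : ℝ)..1, eulerWeight α β (a + y * I) * upperPow γ (z * (a + y * I))) +
      ∫ t in b..1, eulerWeight α β t * upperPow γ (z * t), ?_, ?_⟩
  · refine ContinuousOn.add (ContinuousOn.add ?_ (ContinuousOn.add (ContinuousOn.sub ?_
      (continuousOn_const.mul ?_)) (continuousOn_const.mul ?_))) ?_
    · refine continuousOn_pathIntegral (by fun_prop) hw1 ?_
      rintro z ⟨hz, hza, hzb⟩ t ht
      rw [uIcc_of_le ha.le] at ht
      have := hre z hzb
      refine ⟨by simpa using mul_nonneg hz ht.1, fun h => ?_⟩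
      have h := congrArg re h
      simp at h
      nlinarith [ht.2]
    · refine continuousOn_pathIntegral (by fun_prop) (hwc _ _ _ (by fun_prop) ?_) ?_
      · intro t ht
        rw [uIcc_of_le hab] at ht
        simp
        exact ⟨by linarith [ht.1], by linarith [ht.2]⟩
      · rintro z ⟨hz, hza, hzb⟩ t ht
        rw [uIcc_of_le hab] at ht
        have h1 := hre z hzb
        have h2 : 0 ≤ z.im * t := mul_nonneg hz (by linarith [ht.1])
        refine ⟨by simp; linarith, fun h => ?_⟩
        have h := congrArg im h
        simp at h
        linarith
    · refine continuousOn_pathIntegral (by fun_prop) (hwc _ _ _ (by fun_prop) ?_) ?_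
      · intro t ht
        simp
        exact ⟨by linarith, by linarith⟩
      · rintro z ⟨hz, hza, hzb⟩ t ht
        rw [uIcc_of_le zero_le_one] at ht
        have h1 := hre z hzb
        have h2 : 0 ≤ z.im * b := by positivity
        have h3 : 0 ≤ z.re * t := mul_nonneg h1.le ht.1
        refine ⟨by simp; linarith, fun h => ?_⟩
        have hi := congrArg im h
        have hr := congrArg re h
        simp at hi hr
        nlinarith [mul_nonneg hz ht.1]
    · refine continuousOn_pathIntegral (by fun_prop) (hwc _ _ _ (by fun_prop) ?_) ?_
      · intro t ht
        simp
        exact ⟨by linarith, by linarith⟩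
      · rintro z ⟨hz, hza, hzb⟩ t ht
        rw [uIcc_of_le zero_le_one] at ht
        have h1 := hre z hzb
        have h2 : 0 ≤ z.im * a := by positivity
        have h3 : 0 ≤ z.re * t := mul_nonneg h1.le ht.1
        refine ⟨by simp; linarith, fun h => ?_⟩
        have hi := congrArg im h
        have hr := congrArg re h
        simp at hi hr
        nlinarith [mul_nonneg hz ht.1]
    · refine continuousOn_pathIntegral (by fun_prop) hw3 ?_
      rintro z ⟨hz, hza, hzb⟩ t ht
      rw [uIcc_of_le hb.le] at ht
      have := hre z hzb
      refine ⟨by simpa using mul_nonneg hz (hb0.le.trans ht.1), fun h => ?_⟩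
      have h := congrArg re h
      simp at h
      nlinarith [ht.1]
  · intro z hz hz'
    have hc : ∀ p q : ℝ, 0 ≤ p → p ≤ q → ContinuousOn
        (fun t : ℝ => upperPow γ (z * t)) (uIcc p q) := by
      intro p q hp hpq
      refine (continuousOn_upperPow γ).comp (f := fun t : ℝ => z * t) (by fun_prop) ?_
      intro t ht
      rw [uIcc_of_le hpq] at ht
      refine ⟨by simpa using mul_nonneg hz.le (hp.trans ht.1), fun h => ?_⟩
      have hi := congrArg im h
      have hr := congrArg re h
      simp at hi hr
      rcases hi with hi | hi
      · exact hz.ne' hi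
      · simp [hi] at hr
    have h1 := hw1.mul_continuousOn (hc 0 a le_rfl ha.le)
    have h2 := hw2.mul_continuousOn (hc a b ha.le hab)
    have h3 := hw3.mul_continuousOn (hc b 1 hb0.le hb.le)
    simp only
    rw [eulerIntegral_eq_upperPow hz, ← integral_eulerWeight_mul_upperPow_deform ha hab hb hz hz',
      intervalIntegral.integral_add_adjacent_intervals h1 h2,
      intervalIntegral.integral_add_adjacent_intervals (h1.trans h2) h3]

open Set in
theorem exists_tendsto_eulerIntegral {α β γ : ℂ} (hα : -1 < α.re) (hβ : -1 < β.re)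
    {z : ℂ} (hz : 0 ≤ z.im) (hz1 : 1 < z.re) :
    ∃ y, Tendsto (eulerIntegral α β γ) (𝓝[{w | 0 < w.im ∧ 1 < w.re}] z) (𝓝 y) := by
  have hz0 : 0 < z.re := by linarith
  obtain ⟨G, hG, hGeq⟩ := exists_continuousOn_eq_eulerIntegral (γ := γ) hα hβ
    (a := 1 / (2 * z.re)) (b := (z.re + 1) / (2 * z.re)) (by positivity)
    (by gcongr; linarith) (by rw [div_lt_one (by positivity)]; linarith)
  have hza : 1 / (2 * z.re) * z.re < 1 := by field_simp; norm_num
  have hzb : 1 < (z.re + 1) / (2 * z.re) * z.re := by field_simp; linarith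
  refine ⟨G z, ((hG z ⟨hz, hza, hzb⟩).tendsto.mono_left ?_).congr' ?_⟩
  · refine nhdsWithin_le_iff.2 ?_
    have h1 : ∀ᶠ w : ℂ in 𝓝 z, 1 / (2 * z.re) * w.re < 1 :=
      ContinuousAt.eventually_lt (by fun_prop) (by fun_prop) hza
    have h2 : ∀ᶠ w : ℂ in 𝓝 z, 1 < (z.re + 1) / (2 * z.re) * w.re :=
      ContinuousAt.eventually_lt (by fun_prop) (by fun_prop) hzb
    filter_upwards [self_mem_nhdsWithin, nhdsWithin_le_nhds h1, nhdsWithin_le_nhds h2]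
      with w hw hw1 hw2 using ⟨hw.1.le, hw1, hw2⟩
  · filter_upwards [self_mem_nhdsWithin] with w hw
    exact hGeq w hw.1 (by linarith [hw.2])

theorem conj_eulerIntegral_conj {α β γ z : ℂ} (hz : 0 < z.im) :
    (starRingEnd ℂ) (eulerIntegral α β γ ((starRingEnd ℂ) z)) =
      eulerIntegral ((starRingEnd ℂ) α) ((starRingEnd ℂ) β) ((starRingEnd ℂ) γ) z := by
  unfold eulerIntegral
  rw [← intervalIntegral.intervalIntegral_conj]
  refine intervalIntegral.integral_congr fun t ht => ?_
  rw [Set.uIcc_of_le zero_le_one] at ht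
  have h1 : (t : ℂ).arg ≠ Real.pi := by
    rw [Complex.arg_ofReal_of_nonneg ht.1]; exact Real.pi_pos.ne
  have h2 : (1 - (t : ℂ)).arg ≠ Real.pi := by
    rw [← Complex.ofReal_one, ← Complex.ofReal_sub,
      Complex.arg_ofReal_of_nonneg (by linarith [ht.2])]
    exact Real.pi_pos.ne
  have h3 : (1 - z * (t : ℂ)).arg ≠ Real.pi := by
    rw [Ne, Complex.arg_eq_pi_iff]
    rintro ⟨hr, hi⟩
    simp at hr hi
    rcases hi with hi | hi
    · exact hz.ne' hi
    · simp [hi] at hr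
      linarith
  simp [eulerWeight, Complex.cpow_conj _ _ h1, Complex.cpow_conj _ _ h2,
    Complex.cpow_conj _ _ h3]

open Set in
/-- A function on the open quadrant `{0 < im, 1 < re}` with a limit at every point of the
boundary ray `(1, ∞)` has a continuous boundary value there, attained locally uniformly. -/
theorem exists_boundaryValue {f : ℂ → ℂ}
    (hf : ∀ z : ℂ, 0 ≤ z.im → 1 < z.re →
      ∃ y, Tendsto f (𝓝[{w | 0 < w.im ∧ 1 < w.re}] z) (𝓝 y)) :
    ∃ b : ℝ → ℂ, ContinuousOn b (Ioi 1) ∧ ∀ K ⊆ Ioi (1 : ℝ), IsCompact K →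
      TendstoUniformlyOn (fun (ε x : ℝ) => f (x + ε * Complex.I)) b (𝓝[>] 0) K := by
  set A : Set ℂ := {w | 0 < w.im ∧ 1 < w.re}
  have hcl : {w : ℂ | 0 ≤ w.im ∧ 1 < w.re} ⊆ closure A := by
    intro w hw
    have ht : Tendsto (fun ε : ℝ => w + ε * Complex.I) (𝓝[>] 0) (𝓝 w) := by
      have : Continuous fun ε : ℝ => w + ε * Complex.I := by fun_prop
      simpa using (this.tendsto 0).mono_left nhdsWithin_le_nhds
    refine mem_closure_of_tendsto ht ?_
    filter_upwards [self_mem_nhdsWithin] with ε hε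
    have hε : 0 < ε := hε
    constructor
    · simpa using add_pos_of_nonneg_of_pos hw.1 hε
    · simpa using hw.2
  have hE : ContinuousOn (extendFrom A f) {w : ℂ | 0 ≤ w.im ∧ 1 < w.re} :=
    continuousOn_extendFrom hcl fun z hz => hf z hz.1 hz.2
  have hEA : ∀ w ∈ A, extendFrom A f w = f w := by
    refine extendFrom_extends fun w hw => ?_
    obtain ⟨y, hy⟩ := hf w hw.1.le hw.2
    have hyw : f w = y := tendsto_nhds_unique
      (tendsto_pure_nhds f w) (hy.mono_left (pure_le_nhdsWithin hw))
    rw [← hyw] at hy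
    exact hy
  refine ⟨fun x => extendFrom A f x, ?_, fun K hK hKc => ?_⟩
  · refine hE.comp (f := fun x : ℝ => (x : ℂ)) (by fun_prop) fun x hx => ?_
    simpa using hx
  · have hu : UniformContinuousOn ↿(fun (ε x : ℝ) => extendFrom A f (x + ε * Complex.I))
        (Icc 0 1 ×ˢ K) := by
      refine (isCompact_Icc.prod hKc).uniformContinuousOn_of_continuous ?_
      refine hE.comp (f := fun p : ℝ × ℝ => (p.2 : ℂ) + p.1 * Complex.I) (by fun_prop) ?_
      rintro ⟨ε, x⟩ ⟨hε, hx⟩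
      exact ⟨by simpa using hε.1, by simpa using hK hx⟩
    have ht := hu.tendstoUniformlyOn (left_mem_Icc.2 zero_le_one)
    have hle : 𝓝[>] (0 : ℝ) ≤ 𝓝[Icc 0 1] 0 :=
      nhdsWithin_le_iff.2 (mem_of_superset (Ioc_mem_nhdsGT one_pos) Ioc_subset_Icc_self)
    have ht' := tendstoUniformlyOn_iff_tendstoUniformlyOnFilter.2
      ((tendstoUniformlyOn_iff_tendstoUniformlyOnFilter.1 ht).mono_left hle)
    simp only [Complex.ofReal_zero, zero_mul, add_zero] at ht'
    refine ht'.congr ?_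
    filter_upwards [self_mem_nhdsWithin] with ε hε x hx
    exact hEA _ ⟨by simpa using hε, by simpa using hK hx⟩

theorem Flam_eq (n : ℕ) (lam z : ℂ) : Flam n lam z =
    (Complex.Gamma ((n : ℂ)/2) /
      (Complex.Gamma (((n : ℂ) - 1)/2 - lam) * Complex.Gamma (1/2 + lam))) *
    eulerIntegral (((n : ℂ) - 1)/2 - lam - 1) (lam - 1/2) (-(((n : ℂ) - 1)/2) - lam) z :=
  rfl

theorem admissible.re_bounds {n : ℕ} (hn : 2 ≤ n) {lam : ℂ} (h : admissible n lam) :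
    -1 < (((n : ℂ) - 1)/2 - lam - 1).re ∧ -1 < (lam - 1/2).re := by
  have hn' : (2 : ℝ) ≤ n := by exact_mod_cast hn
  have e : ((n : ℂ) - 1)/2 - lam - 1 = (((n - 1) / 2 - 1 : ℝ) : ℂ) - lam := by push_cast; ring
  have e' : lam - 1/2 = lam - ((1 / 2 : ℝ) : ℂ) := by push_cast; ring
  rw [e, e', Complex.sub_re, Complex.sub_re, Complex.ofReal_re, Complex.ofReal_re]
  rcases h with h | h
  · rw [h.1]; constructor <;> linarith
  · constructor <;> linarith [h.2.1, h.2.2]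

open Filter Topology in
theorem stmt11 (n : ℕ) (hn : 2 ≤ n) (lam : ℂ) (hlam : admissible n lam) :
    ∃ bp bm : ℝ → ℂ,
      ContinuousOn bp (Set.Ioi (1 : ℝ)) ∧ ContinuousOn bm (Set.Ioi (1 : ℝ)) ∧
      ∀ K ⊆ Set.Ioi (1 : ℝ), IsCompact K →
        TendstoUniformlyOn
          (fun (ε : ℝ) (x : ℝ) => Flam n lam ((x : ℂ) + (ε : ℂ) * Complex.I)) bp
          (𝓝[>] (0 : ℝ)) K ∧
        TendstoUniformlyOn
          (fun (ε : ℝ) (x : ℝ) => Flam n lam ((x : ℂ) - (ε : ℂ) * Complex.I)) bm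
          (𝓝[>] (0 : ℝ)) K := by
  obtain ⟨hα, hβ⟩ := hlam.re_bounds hn
  obtain ⟨bp, hbp, hbpK⟩ := exists_boundaryValue (f := Flam n lam) fun z hz hz1 => by
    obtain ⟨y, hy⟩ := exists_tendsto_eulerIntegral hα hβ hz hz1
    exact ⟨_, hy.const_mul _⟩
  obtain ⟨bm, hbm, hbmK⟩ := exists_boundaryValue
    (f := fun z => (starRingEnd ℂ) (Flam n lam ((starRingEnd ℂ) z))) fun z hz hz1 => by
      obtain ⟨y, hy⟩ := exists_tendsto_eulerIntegral
        (α := (starRingEnd ℂ) (((n : ℂ) - 1)/2 - lam - 1))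
        (β := (starRingEnd ℂ) (lam - 1/2))
        (γ := (starRingEnd ℂ) (-(((n : ℂ) - 1)/2) - lam))
        (by rwa [Complex.conj_re]) (by rwa [Complex.conj_re]) hz hz1
      refine ⟨_, (hy.const_mul ((starRingEnd ℂ) (Complex.Gamma ((n : ℂ)/2) /
        (Complex.Gamma (((n : ℂ) - 1)/2 - lam) * Complex.Gamma (1/2 + lam))))).congr' ?_⟩
      filter_upwards [self_mem_nhdsWithin] with w hw
      rw [Flam_eq, map_mul, conj_eulerIntegral_conj hw.1]
  refine ⟨bp, fun x => (starRingEnd ℂ) (bm x), hbp,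
    Complex.continuous_conj.comp_continuousOn hbm, fun K hK hKc => ⟨hbpK K hK hKc, ?_⟩⟩
  have h := Complex.conjLIE.isometry.uniformContinuous.comp_tendstoUniformlyOn (hbmK K hK hKc)
  simpa [Function.comp_def, sub_eq_add_neg] using h
end

section
/- Let n ≥ 3 be odd, ρ = (n−1)/2, and let λ be either purely imaginary with nonnegative imaginary part or real with 0 < λ < ρ. For every x ∈ (1,2): lim_{ε→0⁺} F_λ(x ± iε) = (Γ(n/2)Γ((2−n)/2)/(Γ(1/2+λ)Γ(1/2−λ))) · Σ_{k=0}^∞ ((ρ+λ)_k(ρ−λ)_k/((n/2)_k k!))(1−x)^k + e^{∓iπ(2−n)/2} (x−1)^{(2−n)/2} · (Γ(n/2)Γ((n−2)/2)/(Γ(ρ+λ)Γ(ρ−λ))) · Σ_{k=0}^∞ ((1/2−λ)_k(1/2+λ)_k/(((4−n)/2)_k k!))(1−x)^k, where (x−1)^{(2−n)/2} is the real power of the positive number x−1, the two power series converge since |1−x|<1, and (a)_k = a(a+1)⋯(a+k−1). -/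
open scoped BigOperators
open Filter Topology

section HypergeometricSeries

/-- The sum of the Gauss hypergeometric series. -/
noncomputable def hypSum (a b c z : ℂ) : ℂ := ∑' k, hypTerm a b c z k

lemma ascPochhammer_eval_ne_zero {c : ℂ} (hc : ∀ k : ℕ, c ≠ -k) (k : ℕ) :
    (ascPochhammer ℂ k).eval c ≠ 0 := by
  rw [Ne, ascPochhammer_eval_eq_zero_iff]
  rintro ⟨j, -, hj⟩
  exact hc j (by rw [hj, neg_neg])

lemma hypTerm_eq_mul_pow (a b c z : ℂ) (k : ℕ) :
    hypTerm a b c z k = hypTerm a b c 1 k * z ^ k := by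
  simp [hypTerm]

@[simp] lemma hypTerm_zero (a b c z : ℂ) : hypTerm a b c z 0 = 1 := by
  simp [hypTerm]

@[simp] lemma hypSum_zero_right (a b c : ℂ) : hypSum a b c 0 = 1 := by
  rw [hypSum, tsum_eq_single 0]
  · simp
  · intro k hk
    simp [hypTerm, hk]

lemma hypTerm_succ {a b c : ℂ} (hc : ∀ k : ℕ, c ≠ -k) (z : ℂ) (k : ℕ) :
    (k + 1) * (c + k) * hypTerm a b c z (k + 1) = (a + k) * (b + k) * z * hypTerm a b c z k := by
  have h1 := ascPochhammer_eval_ne_zero hc k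
  have h2 : c + k ≠ 0 := fun h => hc k (eq_neg_of_add_eq_zero_left h)
  have h3 : (k.factorial : ℂ) ≠ 0 := by exact_mod_cast k.factorial_ne_zero
  have h4 : (k + 1 : ℂ) ≠ 0 := by exact_mod_cast k.succ_ne_zero
  simp only [hypTerm, ascPochhammer_succ_eval, Nat.factorial_succ]
  push_cast
  field_simp
  ring

lemma ascPochhammer_eval_succ_left (a : ℂ) (k : ℕ) :
    (ascPochhammer ℂ (k + 1)).eval a = a * (ascPochhammer ℂ k).eval (a + 1) := by
  simp [ascPochhammer_succ_left]

lemma ne_neg_nat_add_one {c : ℂ} (hc : ∀ k : ℕ, c ≠ -k) (k : ℕ) : c + 1 ≠ -k := fun h =>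
  hc (k + 1) (by push_cast; linear_combination h)

lemma hypTerm_succ_eq_shift {a b c : ℂ} (hc : ∀ k : ℕ, c ≠ -k) (k : ℕ) :
    hypTerm a b c 1 (k + 1) * (k + 1) =
      a * b / c * hypTerm (a + 1) (b + 1) (c + 1) 1 k := by
  have h0 : c ≠ 0 := by simpa using hc 0
  have h1 := ascPochhammer_eval_ne_zero (ne_neg_nat_add_one hc) k
  have h3 : (k.factorial : ℂ) ≠ 0 := by exact_mod_cast k.factorial_ne_zero
  have h4 : (k + 1 : ℂ) ≠ 0 := by exact_mod_cast k.succ_ne_zero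
  simp only [hypTerm, ascPochhammer_eval_succ_left, Nat.factorial_succ]
  push_cast
  field_simp
  simp

lemma hypTerm_shift_third {a b c : ℂ} (hc : ∀ k : ℕ, c ≠ -k) (z : ℂ) (k : ℕ) :
    (c + k) * hypTerm a b (c + 1) z k = c * hypTerm a b c z k := by
  have h0 : c ≠ 0 := by simpa using hc 0
  have h1 := ascPochhammer_eval_ne_zero hc k
  have h2 : c + k ≠ 0 := fun h => hc k (eq_neg_of_add_eq_zero_left h)
  have h3 : (k.factorial : ℂ) ≠ 0 := by exact_mod_cast k.factorial_ne_zero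
  have h5 := ascPochhammer_eval_ne_zero (ne_neg_nat_add_one hc) k
  have h : (c + k) * (ascPochhammer ℂ k).eval c = c * (ascPochhammer ℂ k).eval (c + 1) := by
    rw [← ascPochhammer_eval_succ_left, ascPochhammer_succ_eval, mul_comm]
  simp only [hypTerm]
  field_simp
  linear_combination (ascPochhammer ℂ k).eval a * (ascPochhammer ℂ k).eval b * z ^ k * h

lemma norm_ascPochhammer_eval_le {a : ℂ} {A : ℝ} (h : ‖a‖ ≤ A) (k : ℕ) :
    ‖(ascPochhammer ℂ k).eval a‖ ≤ ‖(ascPochhammer ℂ k).eval (A : ℂ)‖ := by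
  have hA : 0 ≤ A := (norm_nonneg a).trans h
  induction k with
  | zero => simp
  | succ k ih =>
    rw [ascPochhammer_succ_eval, ascPochhammer_succ_eval, norm_mul, norm_mul]
    gcongr
    calc ‖a + k‖ ≤ ‖a‖ + ‖(k : ℂ)‖ := norm_add_le _ _
      _ ≤ A + k := by simpa using h
      _ = ‖(A + k : ℂ)‖ := by
        rw [show (A + k : ℂ) = ((A + k : ℝ) : ℂ) by push_cast; rfl, Complex.norm_real,
          Real.norm_of_nonneg (by positivity)]

lemma norm_hypTerm_le {a b z : ℂ} (c : ℂ) {A B r : ℝ} (ha : ‖a‖ ≤ A) (hb : ‖b‖ ≤ B)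
    (hz : ‖z‖ ≤ r) (k : ℕ) : ‖hypTerm a b c z k‖ ≤ ‖hypTerm A B c r k‖ := by
  have hr : 0 ≤ r := (norm_nonneg z).trans hz
  simp only [hypTerm, norm_mul, norm_div, norm_pow]
  have h1 := norm_ascPochhammer_eval_le ha k
  have h2 := norm_ascPochhammer_eval_le hb k
  have h3 : ‖z‖ ≤ ‖(r : ℂ)‖ := by simpa [abs_of_nonneg hr] using hz
  gcongr

lemma summable_norm_hypTerm {a b c z : ℂ} (hc : ∀ k : ℕ, c ≠ -k) (hz : ‖z‖ < 1) :
    Summable fun k => ‖hypTerm a b c z k‖ := by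
  obtain ⟨r, hzr, hr⟩ := exists_between hz
  refine summable_of_ratio_norm_eventually_le hr ?_
  have key : Tendsto (fun k : ℕ => (a + k) / (c + k) * ((b + k) / (1 + k)) * z) atTop
      (𝓝 (1 * 1 * z)) := by
    have aux (u v : ℂ) : Tendsto (fun k : ℕ => (u + k) / (v + k)) atTop (𝓝 1) := by
      simpa using tendsto_add_mul_div_add_mul_atTop_nhds u v (1 : ℂ) (one_ne_zero (α := ℂ))
    exact ((aux a c).mul (aux b 1)).mul_const z
  have := key.norm.eventually_lt_const (u := r) (by simpa using hzr)
  filter_upwards [this] with k hk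
  have h2 : c + k ≠ 0 := fun h => hc k (eq_neg_of_add_eq_zero_left h)
  have h4 : (1 + k : ℂ) ≠ 0 := by rw [add_comm]; exact_mod_cast k.succ_ne_zero
  have : hypTerm a b c z (k + 1) =
      ((a + k) / (c + k) * ((b + k) / (1 + k)) * z) * hypTerm a b c z k := by
    have := hypTerm_succ (a := a) (b := b) hc z k
    field_simp
    linear_combination this
  rw [this]
  simp only [norm_mul, norm_norm] at hk ⊢
  gcongr

lemma summable_hypTerm {a b c z : ℂ} (hc : ∀ k : ℕ, c ≠ -k) (hz : ‖z‖ < 1) :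
    Summable (hypTerm a b c z) :=
  (summable_norm_hypTerm hc hz).of_norm

lemma hasDerivAt_hypSum {a b c z : ℂ} (hc : ∀ k : ℕ, c ≠ -k) (hz : ‖z‖ < 1) :
    HasDerivAt (hypSum a b c) (a * b / c * hypSum (a + 1) (b + 1) (c + 1) z) z := by
  obtain ⟨r, hzr, hr⟩ := exists_between hz
  have hr0 : 0 ≤ r := (norm_nonneg z).trans hzr.le
  have hc' := ne_neg_nat_add_one hc
  have hterm (w : ℂ) (k : ℕ) : hypTerm a b c 1 (k + 1) * (((k + 1 : ℕ) : ℂ) * w ^ k) =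
      a * b / c * hypTerm (a + 1) (b + 1) (c + 1) w k := by
    rw [hypTerm_eq_mul_pow _ _ _ w]
    have := hypTerm_succ_eq_shift (a := a) (b := b) hc k
    push_cast
    linear_combination w ^ k * this
  have hsum (w : ℂ) (hw : ‖w‖ < 1) : HasSum
      (fun k : ℕ => hypTerm a b c 1 k * (k * w ^ (k - 1)))
      (a * b / c * hypSum (a + 1) (b + 1) (c + 1) w) := by
    rw [← hasSum_nat_add_iff' 1]
    simpa [hterm, hypSum, -Nat.cast_add] using
      (summable_hypTerm (a := a + 1) (b := b + 1) hc' hw).hasSum.mul_left (a * b / c)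
  have hu : Summable fun k : ℕ => ‖hypTerm a b c 1 k * (k * (r : ℂ) ^ (k - 1))‖ := by
    rw [← summable_nat_add_iff 1]
    simp only [Nat.add_sub_cancel, hterm, norm_mul]
    exact (summable_norm_hypTerm hc' (by simpa [abs_of_nonneg hr0] using hr)).mul_left _
  have key := hasDerivAt_tsum_of_isPreconnected (𝕜 := ℂ) (g := fun k w => hypTerm a b c w k)
    (g' := fun k w => hypTerm a b c 1 k * (k * w ^ (k - 1))) (t := Metric.ball 0 r) (y₀ := z)
    hu Metric.isOpen_ball (convex_ball _ _).isPreconnected ?_ ?_ (by simpa using hzr)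
    (summable_hypTerm hc hz) (by simpa using hzr)
  · rw [(hsum z hz).tsum_eq] at key
    exact key
  · intro k w _
    have := (hasDerivAt_pow k w).const_mul (hypTerm a b c 1 k)
    exact this.congr_of_eventuallyEq (Eventually.of_forall fun w => hypTerm_eq_mul_pow a b c w k)
  · intro k w hw
    have hw' : ‖w‖ ≤ ‖(r : ℂ)‖ := by
      simpa [abs_of_nonneg hr0] using (mem_ball_zero_iff.1 hw).le
    simp only [norm_mul, norm_pow]
    gcongr

lemma hasSum_natCast_mul_hypTerm {a b c z : ℂ} (hc : ∀ k : ℕ, c ≠ -k) (hz : ‖z‖ < 1) :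
    HasSum (fun k : ℕ => k * hypTerm a b c z k)
      (z * (a * b / c * hypSum (a + 1) (b + 1) (c + 1) z)) := by
  rw [← hasSum_nat_add_iff' 1]
  have := ((summable_hypTerm (a := a + 1) (b := b + 1) (ne_neg_nat_add_one hc) hz).hasSum.mul_left
    (a * b / c)).mul_left z
  simp only [Finset.range_one, Finset.sum_singleton, Nat.cast_zero, zero_mul, sub_zero]
  refine this.congr_fun fun k => ?_
  rw [hypTerm_eq_mul_pow, hypTerm_eq_mul_pow (a + 1)]
  have := hypTerm_succ_eq_shift (a := a) (b := b) hc k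
  push_cast
  linear_combination z ^ (k + 1) * this

lemma hasSum_hypTerm {a b c z : ℂ} (hc : ∀ k : ℕ, c ≠ -k) (hz : ‖z‖ < 1) :
    HasSum (hypTerm a b c z) (hypSum a b c z) :=
  (summable_hypTerm hc hz).hasSum

lemma continuous_hypSum_param {f g : ℂ → ℂ} (hf : Continuous f) (hg : Continuous g) {c z : ℂ}
    (hc : ∀ k : ℕ, c ≠ -k) (hz : ‖z‖ < 1) : Continuous fun s => hypSum (f s) (g s) c z := by
  rw [continuous_iff_continuousAt]
  intro s₀
  let U : Set ℂ := {s | ‖f s‖ < ‖f s₀‖ + 1} ∩ {s | ‖g s‖ < ‖g s₀‖ + 1}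
  have hU : IsOpen U := (isOpen_lt hf.norm continuous_const).inter
    (isOpen_lt hg.norm continuous_const)
  have hs : s₀ ∈ U := ⟨by simp, by simp⟩
  refine ContinuousOn.continuousAt (s := U) ?_ (hU.mem_nhds hs)
  refine continuousOn_tsum (u := fun k => ‖hypTerm ((‖f s₀‖ + 1 : ℝ) : ℂ)
    ((‖g s₀‖ + 1 : ℝ) : ℂ) c ((‖z‖ : ℝ) : ℂ) k‖) ?_ ?_ ?_
  · intro k
    unfold hypTerm
    have h1 := ((ascPochhammer ℂ k).continuous).comp hf
    have h2 := ((ascPochhammer ℂ k).continuous).comp hg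
    exact (((h1.mul h2).div_const _).mul_const _).continuousOn
  · exact summable_norm_hypTerm hc (by simpa using hz)
  · intro k s hs
    exact norm_hypTerm_le c hs.1.le hs.2.le le_rfl k

end HypergeometricSeries

section Trigonometric

lemma eq_cos_and_eq_sin_of_hasDerivAt {φ ψ : ℝ → ℂ} {μ : ℂ} {s : Set ℝ} (hs : IsOpen s)
    (hs' : IsPreconnected s) (h0 : (0 : ℝ) ∈ s)
    (hφ : ∀ θ ∈ s, HasDerivAt φ (-μ * ψ θ) θ) (hψ : ∀ θ ∈ s, HasDerivAt ψ (μ * φ θ) θ)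
    (hφ0 : φ 0 = 1) (hψ0 : ψ 0 = 0) {θ : ℝ} (hθ : θ ∈ s) :
    φ θ = Complex.cos (μ * θ) ∧ ψ θ = Complex.sin (μ * θ) := by
  have hid (w : ℂ) : HasDerivAt (fun w : ℂ => μ * w) μ w := by
    simpa using (hasDerivAt_id w).const_mul μ
  have hc (t : ℝ) := (hid t).ccos.comp_ofReal
  have hsn (t : ℝ) := (hid t).csin.comp_ofReal
  have hu (t) (ht : t ∈ s) := ((hφ t ht).mul (hc t)).add ((hψ t ht).mul (hsn t))
  have hv (t) (ht : t ∈ s) := ((hψ t ht).mul (hc t)).sub ((hφ t ht).mul (hsn t))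
  have eu := hs.is_const_of_deriv_eq_zero hs'
    (fun t ht => (hu t ht).differentiableAt.differentiableWithinAt)
    (fun t ht => by rw [(hu t ht).deriv]; simp; ring) hθ h0
  have ev := hs.is_const_of_deriv_eq_zero hs'
    (fun t ht => (hv t ht).differentiableAt.differentiableWithinAt)
    (fun t ht => by rw [(hv t ht).deriv]; simp; ring) hθ h0
  simp only [Pi.add_apply, Pi.sub_apply, Pi.mul_apply, hφ0, hψ0, Complex.ofReal_zero, mul_zero,
    Complex.cos_zero, Complex.sin_zero, mul_one, add_zero, sub_zero] at eu ev
  have h1 := Complex.sin_sq_add_cos_sq (μ * θ)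
  constructor
  · linear_combination (-φ θ) * h1 + Complex.cos (μ * θ) * eu - Complex.sin (μ * θ) * ev
  · linear_combination (-ψ θ) * h1 + Complex.sin (μ * θ) * eu + Complex.cos (μ * θ) * ev

lemma half_odd_ne_neg_nat (j : ℤ) (k : ℕ) : (j : ℂ) + 1 / 2 ≠ -k := by
  intro h
  have : ((2 * j + 1 + 2 * k : ℤ) : ℂ) = 0 := by push_cast; linear_combination 2 * h
  have : 2 * j + 1 + 2 * k = 0 := by exact_mod_cast this
  omega

lemma one_half_ne_neg_nat (k : ℕ) : (1 / 2 : ℂ) ≠ -k := by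
  simpa using half_odd_ne_neg_nat 0 k

lemma hypSum_shift_third {a b c z : ℂ} (hc : ∀ k : ℕ, c ≠ -k) (hz : ‖z‖ < 1) :
    c * hypSum a b (c + 1) z + z * (a * b / (c + 1) * hypSum (a + 1) (b + 1) (c + 1 + 1) z) =
      c * hypSum a b c z := by
  have hc' := ne_neg_nat_add_one hc
  have h1 := ((hasSum_hypTerm (a := a) (b := b) hc' hz).mul_left c).add
    (hasSum_natCast_mul_hypTerm (a := a) (b := b) hc' hz)
  refine (h1.congr_fun fun k => ?_).unique ((hasSum_hypTerm hc hz).mul_left c)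
  rw [← hypTerm_shift_third hc]
  ring

lemma hypSum_first_order_relation {lam z : ℂ} (hz : ‖z‖ < 1) :
    (1 - 2 * z) * hypSum (lam + 1) (-lam + 1) (1 / 2 + 1) z + 2 * (1 - z) * (z *
      ((lam + 1) * (-lam + 1) / (1 / 2 + 1) *
        hypSum (lam + 1 + 1) (-lam + 1 + 1) (1 / 2 + 1 + 1) z)) =
      hypSum lam (-lam) (1 / 2) z := by
  have hc := one_half_ne_neg_nat
  have hc' := ne_neg_nat_add_one hc
  have hG := hasSum_hypTerm (a := lam + 1) (b := -lam + 1) hc' hz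
  have hE := hasSum_natCast_mul_hypTerm (a := lam + 1) (b := -lam + 1) hc' hz
  have hF := (hasSum_nat_add_iff' 1).2 (hasSum_hypTerm (a := lam) (b := -lam) hc hz)
  have h1 := ((hasSum_nat_add_iff' 1).2 (hG.add (hE.mul_left 2))).sub
    ((hG.add hE).mul_left (2 * z))
  have := (h1.congr_fun (g := fun k => hypTerm lam (-lam) (1 / 2) z (k + 1)) fun k => ?_).unique hF
  · simp only [Finset.range_one, Finset.sum_singleton, hypTerm_zero, Nat.cast_zero, zero_mul,
      mul_zero, add_zero] at this
    linear_combination this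
  · have h2 := hypTerm_succ_eq_shift (a := lam) (b := -lam) hc k
    have h3 := hypTerm_succ (a := lam + 1) (b := -lam + 1) hc' z k
    have h4 : (k + 1 : ℂ) ≠ 0 := by exact_mod_cast k.succ_ne_zero
    have h5 : hypTerm lam (-lam) (1 / 2) z (k + 1) * (k + 1) =
        lam * (-lam) / (1 / 2) * (z * hypTerm (lam + 1) (-lam + 1) (1 / 2 + 1) z k) := by
      rw [hypTerm_eq_mul_pow, hypTerm_eq_mul_pow (lam + 1)]
      linear_combination z ^ (k + 1) * h2
    apply mul_left_cancel₀ h4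
    push_cast
    linear_combination h5 - 2 * h3

lemma hypSum_one_half_relation {lam z : ℂ} (hz : ‖z‖ < 1) :
    -hypSum (1 / 2 - lam) (1 / 2 + lam) (1 / 2) z + 2 * (1 - z) *
      ((1 / 2 - lam) * (1 / 2 + lam) / (1 / 2) *
        hypSum (1 / 2 - lam + 1) (1 / 2 + lam + 1) (1 / 2 + 1) z) =
      -(4 * lam ^ 2) * hypSum (1 / 2 - lam) (1 / 2 + lam) (1 / 2 + 1) z := by
  have hc := one_half_ne_neg_nat
  have hc' := ne_neg_nat_add_one hc
  have hP := hasSum_hypTerm (a := 1 / 2 - lam) (b := 1 / 2 + lam) hc hz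
  have hQ := hasSum_hypTerm (a := 1 / 2 - lam) (b := 1 / 2 + lam) hc' hz
  have hE := hasSum_natCast_mul_hypTerm (a := 1 / 2 - lam) (b := 1 / 2 + lam) hc hz
  have hD := (hasSum_hypTerm (a := 1 / 2 - lam + 1) (b := 1 / 2 + lam + 1) hc' hz).mul_left
    ((1 / 2 - lam) * (1 / 2 + lam) / (1 / 2))
  have h1 := ((hD.mul_left 2).sub hP).sub (hE.mul_left 2)
  have := (h1.congr_fun (g := fun k => -(4 * lam ^ 2) *
    hypTerm (1 / 2 - lam) (1 / 2 + lam) (1 / 2 + 1) z k) fun k => ?_).unique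
      (hQ.mul_left (-(4 * lam ^ 2)))
  · linear_combination this
  · have h2 := hypTerm_succ_eq_shift (a := 1 / 2 - lam) (b := 1 / 2 + lam) hc k
    have h3 := hypTerm_succ (a := 1 / 2 - lam) (b := 1 / 2 + lam) hc 1 k
    have h6 := hypTerm_shift_third (a := 1 / 2 - lam) (b := 1 / 2 + lam) hc 1 k
    have h4 : (1 / 2 + k : ℂ) ≠ 0 := fun h => hc k (eq_neg_of_add_eq_zero_left h)
    rw [hypTerm_eq_mul_pow _ _ _ z, hypTerm_eq_mul_pow _ _ _ z, hypTerm_eq_mul_pow _ _ _ z]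
    apply mul_left_cancel₀ h4
    linear_combination 2 * (1 / 2 + k) * z ^ k * h2 - 2 * z ^ k * h3 - 4 * lam ^ 2 * z ^ k * h6

lemma norm_sin_sq_lt_one {θ : ℝ} (hθ : θ ∈ Set.Ioo (-(Real.pi / 2)) (Real.pi / 2)) :
    ‖Complex.sin θ ^ 2‖ < 1 := by
  have h1 := Real.cos_pos_of_mem_Ioo hθ
  have h2 := Real.sin_sq_add_cos_sq θ
  rw [← Complex.ofReal_sin, ← Complex.ofReal_pow, Complex.norm_real,
    Real.norm_of_nonneg (sq_nonneg _)]
  nlinarith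

lemma hasDerivAt_hypSum_sin_sq {a b c : ℂ} (hc : ∀ k : ℕ, c ≠ -k) {θ : ℝ}
    (hθ : θ ∈ Set.Ioo (-(Real.pi / 2)) (Real.pi / 2)) :
    HasDerivAt (fun t : ℝ => hypSum a b c (Complex.sin t ^ 2))
      (a * b / c * hypSum (a + 1) (b + 1) (c + 1) (Complex.sin θ ^ 2) *
        (2 * Complex.sin θ * Complex.cos θ)) θ := by
  have h := (hasDerivAt_hypSum (a := a) (b := b) hc (norm_sin_sq_lt_one hθ)).comp (θ : ℂ)
    ((Complex.hasDerivAt_sin (θ : ℂ)).pow 2)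
  simpa [Function.comp_def] using h.comp_ofReal

lemma hypSum_sin_sq_eq_cos (lam : ℂ) {θ : ℝ}
    (hθ : θ ∈ Set.Ioo (-(Real.pi / 2)) (Real.pi / 2)) :
    hypSum lam (-lam) (1 / 2) (Complex.sin θ ^ 2) = Complex.cos (2 * lam * θ) := by
  have hc := one_half_ne_neg_nat
  refine (eq_cos_and_eq_sin_of_hasDerivAt (s := Set.Ioo (-(Real.pi / 2)) (Real.pi / 2))
    (φ := fun t : ℝ => hypSum lam (-lam) (1 / 2) (Complex.sin t ^ 2))
    (ψ := fun t : ℝ => 2 * lam * (Complex.sin t * Complex.cos t *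
      hypSum (lam + 1) (-lam + 1) (1 / 2 + 1) (Complex.sin t ^ 2)))
    (μ := 2 * lam) isOpen_Ioo isPreconnected_Ioo (by constructor <;> simp [Real.pi_pos])
    (fun t ht => ?_) (fun t ht => ?_) (by simp) (by simp) hθ).1
  · convert hasDerivAt_hypSum_sin_sq (a := lam) (b := -lam) hc ht using 1
    ring
  · convert! ((((Complex.hasDerivAt_sin (t : ℂ)).mul (Complex.hasDerivAt_cos (t : ℂ))).comp_ofReal.mul
      (hasDerivAt_hypSum_sin_sq (a := lam + 1) (b := -lam + 1) (ne_neg_nat_add_one hc)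
        ht)).const_mul (2 * lam)) using 1
    rw [← hypSum_first_order_relation (norm_sin_sq_lt_one ht)]
    simp only [Pi.mul_apply]
    have h1 := Complex.cos_sq' (t : ℂ)
    ring_nf
    rw [h1]
    ring

lemma hypSum_sin_sq_eq_sin (lam : ℂ) {θ : ℝ}
    (hθ : θ ∈ Set.Ioo (-(Real.pi / 2)) (Real.pi / 2)) :
    2 * lam * (Complex.sin θ * hypSum (1 / 2 - lam) (1 / 2 + lam) (3 / 2) (Complex.sin θ ^ 2)) =
      Complex.sin (2 * lam * θ) := by
  have hc := one_half_ne_neg_nat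
  rw [show (3 / 2 : ℂ) = 1 / 2 + 1 by norm_num]
  refine (eq_cos_and_eq_sin_of_hasDerivAt (s := Set.Ioo (-(Real.pi / 2)) (Real.pi / 2))
    (φ := fun t : ℝ => Complex.cos t *
      hypSum (1 / 2 - lam) (1 / 2 + lam) (1 / 2) (Complex.sin t ^ 2))
    (ψ := fun t : ℝ => 2 * lam * (Complex.sin t *
      hypSum (1 / 2 - lam) (1 / 2 + lam) (1 / 2 + 1) (Complex.sin t ^ 2)))
    (μ := 2 * lam) isOpen_Ioo isPreconnected_Ioo (by constructor <;> simp [Real.pi_pos])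
    (fun t ht => ?_) (fun t ht => ?_) (by simp) (by simp) hθ).2
  · convert! (Complex.hasDerivAt_cos (t : ℂ)).comp_ofReal.mul
      (hasDerivAt_hypSum_sin_sq (a := 1 / 2 - lam) (b := 1 / 2 + lam) hc ht) using 1
    have h1 := Complex.cos_sq' (t : ℂ)
    have h2 := hypSum_one_half_relation (lam := lam) (norm_sin_sq_lt_one ht)
    linear_combination (-Complex.sin t) * h2 - Complex.sin t * 2 *
      ((1 / 2 - lam) * (1 / 2 + lam) / (1 / 2) *
        hypSum (1 / 2 - lam + 1) (1 / 2 + lam + 1) (1 / 2 + 1) (Complex.sin t ^ 2)) * h1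
  · convert! (((Complex.hasDerivAt_sin (t : ℂ)).comp_ofReal.mul
      (hasDerivAt_hypSum_sin_sq (a := 1 / 2 - lam) (b := 1 / 2 + lam) (ne_neg_nat_add_one hc)
        ht)).const_mul (2 * lam)) using 1
    have h2 := hypSum_shift_third (a := 1 / 2 - lam) (b := 1 / 2 + lam) hc (norm_sin_sq_lt_one ht)
    linear_combination (-4) * lam * Complex.cos t * h2

end Trigonometric

section Connection

/-- The right-hand side of the connection formula between `0` and `1` for the hypergeometric
function with parameters `m + lam`, `m - lam`, `m + 1/2`. -/
noncomputable def hypConnection (m : ℕ) (lam z : ℂ) : ℂ :=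
  Complex.Gamma (m + 1 / 2) * Complex.Gamma (1 / 2 - m) *
      ((Complex.Gamma (1 / 2 + lam))⁻¹ * (Complex.Gamma (1 / 2 - lam))⁻¹) *
      hypSum (m + lam) (m - lam) (m + 1 / 2) (1 - z) +
    Complex.Gamma (m + 1 / 2) * Complex.Gamma (m - 1 / 2) *
      ((Complex.Gamma (m + lam))⁻¹ * (Complex.Gamma (m - lam))⁻¹) *
      ((1 - z) ^ (1 / 2 - m : ℂ) * hypSum (1 / 2 - lam) (1 / 2 + lam) (3 / 2 - m) (1 - z))

lemma natCast_add_half_ne_neg_nat (m k : ℕ) : (m + 1 / 2 : ℂ) ≠ -k := by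
  simpa using half_odd_ne_neg_nat m k

lemma half_sub_natCast_ne_neg_nat (m k : ℕ) : (1 / 2 - m : ℂ) ≠ -k := by
  have := half_odd_ne_neg_nat (-m) k
  push_cast at this
  convert this using 1
  ring

lemma three_halves_sub_natCast_ne_neg_nat (m k : ℕ) : (3 / 2 - m : ℂ) ≠ -k := by
  have := half_odd_ne_neg_nat (1 - m) k
  push_cast at this
  convert this using 1
  ring

lemma inv_Gamma_add_mul_inv_Gamma_sub (lam : ℂ) :
    (Complex.Gamma (1 / 2 + lam))⁻¹ * (Complex.Gamma (1 / 2 - lam))⁻¹ =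
      Complex.cos (Real.pi * lam) / Real.pi := by
  have h := Complex.Gamma_mul_Gamma_one_sub (1 / 2 + lam)
  rw [show (1 : ℂ) - (1 / 2 + lam) = 1 / 2 - lam by ring,
    show (Real.pi : ℂ) * (1 / 2 + lam) = Real.pi * lam + Real.pi / 2 by ring,
    Complex.sin_add_pi_div_two] at h
  rw [← mul_inv, h, inv_div]

lemma inv_Gamma_mul_inv_Gamma_neg (lam : ℂ) :
    (Complex.Gamma lam)⁻¹ * (Complex.Gamma (-lam))⁻¹ =
      -lam * Complex.sin (Real.pi * lam) / Real.pi := by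
  rcases eq_or_ne lam 0 with rfl | h0
  · simp
  have h := Complex.Gamma_mul_Gamma_one_sub lam
  rw [show (1 : ℂ) - lam = -lam + 1 by ring, Complex.Gamma_add_one _ (neg_ne_zero.2 h0)] at h
  have h' : (Complex.Gamma lam)⁻¹ * (Complex.Gamma (-lam))⁻¹ =
      -lam * (Complex.Gamma lam * (-lam * Complex.Gamma (-lam)))⁻¹ := by
    rw [mul_inv, mul_inv]
    field_simp
  rw [h', h, inv_div]
  ring

lemma norm_one_sub_ofReal_lt_one {x : ℝ} (hx0 : 0 < x) (hx1 : x < 1) : ‖(1 - x : ℂ)‖ < 1 := by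
  rw [← Complex.ofReal_one, ← Complex.ofReal_sub, Complex.norm_real, Real.norm_eq_abs, abs_lt]
  constructor <;> linarith

lemma norm_ofReal_lt_one {x : ℝ} (hx0 : 0 < x) (hx1 : x < 1) : ‖(x : ℂ)‖ < 1 := by
  rwa [Complex.norm_real, Real.norm_of_nonneg hx0.le]

lemma hypSum_eq_hypConnection_zero (lam : ℂ) {x : ℝ} (hx0 : 0 < x) (hx1 : x < 1) :
    hypSum ((0 : ℕ) + lam) ((0 : ℕ) - lam) ((0 : ℕ) + 1 / 2) x = hypConnection 0 lam x := by
  obtain ⟨θ, hθ0, hθ1, hθ⟩ : ∃ θ : ℝ, 0 < θ ∧ θ < Real.pi / 2 ∧ Real.sin θ = √x := by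
    have hs0 : 0 < √x := Real.sqrt_pos.2 hx0
    have hs1 : √x < 1 := by rw [Real.sqrt_lt' one_pos]; simpa using hx1
    exact ⟨Real.arcsin √x, Real.arcsin_pos.2 hs0, Real.arcsin_lt_pi_div_two.2 hs1,
      Real.sin_arcsin (by linarith) hs1.le⟩
  have hcos : 0 < Real.cos θ := Real.cos_pos_of_mem_Ioo ⟨by linarith, hθ1⟩
  have hx : x = Real.sin θ ^ 2 := by rw [hθ, Real.sq_sqrt hx0.le]
  have h1x : 1 - x = Real.cos θ ^ 2 := by rw [hx, Real.cos_sq']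
  have hxC : (x : ℂ) = Complex.sin θ ^ 2 := by rw [hx]; push_cast; rfl
  have h1xC : (1 - x : ℂ) = Complex.sin (Real.pi / 2 - θ : ℝ) ^ 2 := by
    have : ((1 - x : ℝ) : ℂ) = ((Real.cos θ ^ 2 : ℝ) : ℂ) := by rw [h1x]
    push_cast [Complex.sin_pi_div_two_sub] at this ⊢
    exact this
  have hpow : (1 - x : ℂ) ^ (1 / 2 : ℂ) = Complex.sin (Real.pi / 2 - θ : ℝ) := by
    have : (1 - x : ℂ) = ((Real.cos θ : ℝ) : ℂ) ^ 2 := by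
      rw [← Complex.ofReal_pow, ← h1x]; push_cast; rfl
    rw [this, ← Complex.ofReal_sin, Real.sin_pi_div_two_sub, ← Complex.ofReal_pow,
      show (1 / 2 : ℂ) = ((1 / 2 : ℝ) : ℂ) by push_cast; rfl,
      ← Complex.ofReal_cpow (sq_nonneg _), ← Real.sqrt_eq_rpow, Real.sqrt_sq hcos.le]
  have hη : Real.pi / 2 - θ ∈ Set.Ioo (-(Real.pi / 2)) (Real.pi / 2) := by
    constructor <;> linarith
  have e1 := hypSum_sin_sq_eq_cos lam (θ := θ) ⟨by linarith, hθ1⟩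
  have e2 := hypSum_sin_sq_eq_cos lam hη
  have e3 := hypSum_sin_sq_eq_sin lam hη
  have hpi : (Real.pi : ℂ) ≠ 0 := by exact_mod_cast Real.pi_ne_zero
  have hG : Complex.Gamma (1 / 2) * Complex.Gamma (1 / 2) = Real.pi := by
    have := Complex.Gamma_mul_Gamma_one_sub (1 / 2)
    rw [show (1 - 1 / 2 : ℂ) = 1 / 2 by norm_num,
      show (Real.pi * (1 / 2) : ℂ) = Real.pi / 2 by ring, Complex.sin_pi_div_two] at this
    simpa using this
  have hG' : Complex.Gamma (1 / 2) * Complex.Gamma (0 - 1 / 2) = -2 * Real.pi := by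
    have := Complex.Gamma_add_one (0 - 1 / 2) (by norm_num)
    rw [show (0 - 1 / 2 + 1 : ℂ) = 1 / 2 by norm_num] at this
    linear_combination (-2) * hG + 2 * Complex.Gamma (1 / 2) * this
  simp only [hypConnection, Nat.cast_zero, zero_add, sub_zero, zero_sub lam]
  rw [hpow, inv_Gamma_add_mul_inv_Gamma_sub, inv_Gamma_mul_inv_Gamma_neg, hG, hG', h1xC, hxC, e1,
    e2]
  have hsplit : (2 * lam * θ : ℂ) = Real.pi * lam - 2 * lam * ((Real.pi / 2 - θ : ℝ) : ℂ) := by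
    push_cast
    ring
  rw [hsplit, Complex.cos_sub]
  have hπ : (Real.pi : ℂ) * (Real.pi : ℂ)⁻¹ = 1 := mul_inv_cancel₀ hpi
  linear_combination (-Complex.sin (Real.pi * lam)) * e3 -
    (Complex.cos (Real.pi * lam) * Complex.cos (2 * lam * ((Real.pi / 2 - θ : ℝ) : ℂ)) +
      2 * lam * Complex.sin (Real.pi * lam) * (Complex.sin (Real.pi / 2 - θ : ℝ) *
        hypSum (1 / 2 - lam) (1 / 2 + lam) (3 / 2) (Complex.sin (Real.pi / 2 - θ : ℝ) ^ 2))) * hπ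

lemma hasDerivAt_hypConnection (m : ℕ) (lam : ℂ) {x : ℝ} (hx0 : 0 < x) (hx1 : x < 1) :
    HasDerivAt (fun y : ℝ => hypConnection m lam y)
      (-(Complex.Gamma (m + 1 / 2) * Complex.Gamma (1 / 2 - m) *
        ((Complex.Gamma (1 / 2 + lam))⁻¹ * (Complex.Gamma (1 / 2 - lam))⁻¹) *
        ((m + lam) * (m - lam) / (m + 1 / 2) *
          hypSum (m + lam + 1) (m - lam + 1) (m + 1 / 2 + 1) (1 - x))) -
      Complex.Gamma (m + 1 / 2) * Complex.Gamma (m - 1 / 2) *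
        ((Complex.Gamma (m + lam))⁻¹ * (Complex.Gamma (m - lam))⁻¹) *
        ((1 / 2 - m) * ((1 - x : ℂ) ^ (1 / 2 - (m + 1) : ℂ) *
          hypSum (1 / 2 - lam) (1 / 2 + lam) (1 / 2 - m) (1 - x)))) x := by
  have hw := norm_one_sub_ofReal_lt_one hx0 hx1
  have hsub : HasDerivAt (fun z : ℂ => 1 - z) (-1) (x : ℂ) := by
    simpa using (hasDerivAt_id (x : ℂ)).const_sub 1
  have hpos : (1 - x : ℂ) ∈ Complex.slitPlane := by
    refine Or.inl ?_
    simpa using hx1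
  have hne : (1 - x : ℂ) ≠ 0 := Complex.slitPlane_ne_zero hpos
  have d1 := (hasDerivAt_hypSum (a := m + lam) (b := m - lam)
    (natCast_add_half_ne_neg_nat m) hw).comp (x : ℂ) hsub
  have hc3 := three_halves_sub_natCast_ne_neg_nat m
  have d2 := (hasDerivAt_hypSum (a := 1 / 2 - lam) (b := 1 / 2 + lam) hc3 hw).comp (x : ℂ) hsub
  have d3 := hsub.cpow_const (c := (1 / 2 - m : ℂ)) hpos
  have key := hypSum_shift_third (a := 1 / 2 - lam) (b := 1 / 2 + lam)
    (half_sub_natCast_ne_neg_nat m) hw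
  rw [show (1 / 2 - m + 1 : ℂ) = 3 / 2 - m by ring] at key
  have hp : (1 - x : ℂ) ^ (1 / 2 - m : ℂ) = (1 - x) ^ (1 / 2 - (m + 1) : ℂ) * (1 - x) := by
    rw [show (1 / 2 - m : ℂ) = 1 / 2 - (m + 1) + 1 by ring, Complex.cpow_add _ _ hne,
      Complex.cpow_one]
  convert! ((d1.const_mul (Complex.Gamma (m + 1 / 2) * Complex.Gamma (1 / 2 - m) *
      ((Complex.Gamma (1 / 2 + lam))⁻¹ * (Complex.Gamma (1 / 2 - lam))⁻¹))).add
    ((d3.mul d2).const_mul (Complex.Gamma (m + 1 / 2) * Complex.Gamma (m - 1 / 2) *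
      ((Complex.Gamma (m + lam))⁻¹ * (Complex.Gamma (m - lam))⁻¹)))).comp_ofReal using 1
  simp only [Function.comp_def]
  rw [hp, show (1 / 2 - m - 1 : ℂ) = 1 / 2 - (m + 1) by ring]
  linear_combination Complex.Gamma (m + 1 / 2) * Complex.Gamma (m - 1 / 2) *
    ((Complex.Gamma (m + lam))⁻¹ * (Complex.Gamma (m - lam))⁻¹) *
    (1 - x : ℂ) ^ (1 / 2 - (m + 1) : ℂ) * key

lemma continuous_hypConnection_param (m : ℕ) {z : ℂ} (hz : ‖1 - z‖ < 1) :
    Continuous fun lam => hypConnection m lam z := by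
  have hΓ := Complex.differentiable_one_div_Gamma.continuous
  have h1 := continuous_hypSum_param (f := fun s => m + s) (g := fun s => m - s) (by fun_prop)
    (by fun_prop) (natCast_add_half_ne_neg_nat m) hz
  have h2 := continuous_hypSum_param (f := fun s => 1 / 2 - s) (g := fun s => 1 / 2 + s)
    (by fun_prop) (by fun_prop) (three_halves_sub_natCast_ne_neg_nat m) hz
  have g1 := hΓ.comp (continuous_const.add continuous_id : Continuous fun s : ℂ => 1 / 2 + s)
  have g2 := hΓ.comp (continuous_const.sub continuous_id : Continuous fun s : ℂ => 1 / 2 - s)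
  have g3 := hΓ.comp (continuous_const.add continuous_id : Continuous fun s : ℂ => m + s)
  have g4 := hΓ.comp (continuous_const.sub continuous_id : Continuous fun s : ℂ => m - s)
  exact ((continuous_const.mul (g1.mul g2)).mul h1).add
    ((continuous_const.mul (g3.mul g4)).mul (continuous_const.mul h2))

/-- The connection formula, proved by differentiating the case `m` to obtain the case `m + 1`. -/
theorem hypSum_eq_hypConnection (m : ℕ) (lam : ℂ) {x : ℝ} (hx0 : 0 < x) (hx1 : x < 1) :
    hypSum (m + lam) (m - lam) (m + 1 / 2) x = hypConnection m lam x := by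
  induction m generalizing lam x with
  | zero => exact hypSum_eq_hypConnection_zero lam hx0 hx1
  | succ m ih =>
    have hcont := continuous_hypSum_param (f := fun s => (m + 1 : ℕ) + s)
      (g := fun s => (m + 1 : ℕ) - s) (by fun_prop) (by fun_prop)
      (natCast_add_half_ne_neg_nat (m + 1)) (norm_ofReal_lt_one hx0 hx1)
    have hcont' := continuous_hypConnection_param (m + 1) (norm_one_sub_ofReal_lt_one hx0 hx1)
    have hdense : Dense ({(m : ℂ), -(m : ℂ)}ᶜ : Set ℂ) :=
      (Set.toFinite _).countable.dense_compl ℂ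
    refine congr_fun (Continuous.ext_on hdense hcont hcont' ?_) lam
    intro s hs
    simp only [Set.mem_compl_iff, Set.mem_insert_iff, Set.mem_singleton_iff, not_or] at hs
    have hp : (m : ℂ) + s ≠ 0 := fun h => hs.2 (by linear_combination h)
    have hm : (m : ℂ) - s ≠ 0 := fun h => hs.1 (by linear_combination -h)
    have hc : (m + 1 / 2 : ℂ) ≠ 0 := by simpa using natCast_add_half_ne_neg_nat m 0
    have hc' : (1 / 2 - m : ℂ) ≠ 0 := by simpa using half_sub_natCast_ne_neg_nat m 0
    have hd := (hasDerivAt_hypSum (a := m + s) (b := m - s) (natCast_add_half_ne_neg_nat m)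
      (norm_ofReal_lt_one hx0 hx1)).comp_ofReal
    have hd' := hasDerivAt_hypConnection m s hx0 hx1
    have heq : (fun y : ℝ => hypSum (m + s) (m - s) (m + 1 / 2) y) =ᶠ[𝓝 x]
        fun y : ℝ => hypConnection m s y := by
      filter_upwards [Ioo_mem_nhds hx0 hx1] with y hy
      exact ih s hy.1 hy.2
    have hder := hd.unique (hd'.congr_of_eventuallyEq heq)
    have G1 : Complex.Gamma (m + 1 / 2 + 1) = (m + 1 / 2) * Complex.Gamma (m + 1 / 2) :=
      Complex.Gamma_add_one _ hc
    have G2 : Complex.Gamma (1 / 2 - m) =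
        (1 / 2 - (m + 1)) * Complex.Gamma (1 / 2 - (m + 1)) := by
      rw [← Complex.Gamma_add_one]
      · congr 1; ring
      · intro h; exact hc (by linear_combination -h)
    have G3 : Complex.Gamma (m + 1 - 1 / 2) = (m - 1 / 2) * Complex.Gamma (m - 1 / 2) := by
      rw [← Complex.Gamma_add_one]
      · congr 1; ring
      · intro h; exact hc' (by linear_combination -h)
    have G4 : (Complex.Gamma (m + s))⁻¹ = (m + s) * (Complex.Gamma (m + s + 1))⁻¹ := by
      rw [Complex.Gamma_add_one _ hp, mul_inv, mul_inv_cancel_left₀ hp]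
    have G5 : (Complex.Gamma (m - s))⁻¹ = (m - s) * (Complex.Gamma (m - s + 1))⁻¹ := by
      rw [Complex.Gamma_add_one _ hm, mul_inv, mul_inv_cancel_left₀ hm]
    have hK : (m + s) * (m - s) / (m + 1 / 2 : ℂ) ≠ 0 := div_ne_zero (mul_ne_zero hp hm) hc
    apply mul_left_cancel₀ hK
    simp only [hypConnection]
    push_cast
    rw [show (m + 1 + s : ℂ) = m + s + 1 by ring, show (m + 1 - s : ℂ) = m - s + 1 by ring,
      show (m + 1 + 1 / 2 : ℂ) = m + 1 / 2 + 1 by ring,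
      show (3 / 2 - (m + 1) : ℂ) = 1 / 2 - m by ring, hder, G1, G2, G3, G4, G5]
    have hinv : (m + 1 / 2 : ℂ) * (m + 1 / 2 : ℂ)⁻¹ = 1 := mul_inv_cancel₀ hc
    linear_combination (-((m + s) * (m - s) * (m - 1 / 2) * Complex.Gamma (m + 1 / 2) *
      Complex.Gamma (m - 1 / 2) *
      ((Complex.Gamma (m + s + 1))⁻¹ * (Complex.Gamma (m - s + 1))⁻¹) *
      ((1 - x : ℂ) ^ (1 / 2 - (m + 1) : ℂ) *
        hypSum (1 / 2 - s) (1 / 2 + s) (1 / 2 - m) (1 - x)))) * hinv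

end Connection

section EulerIntegral

lemma hasSum_one_sub_cpow_neg (a : ℂ) {w : ℂ} (hw : ‖w‖ < 1) :
    HasSum (hypTerm a 1 1 w) ((1 - w) ^ (-a)) := by
  have h := (Complex.one_div_one_sub_cpow_hasFPowerSeriesOnBall_zero a).hasSum
    (y := w) (by simpa [← ofReal_norm] using hw)
  rw [Complex.cpow_neg]
  simp only [zero_add, one_div] at h
  convert! h using 1
  funext k
  have hk : (k.factorial : ℂ) ≠ 0 := by exact_mod_cast k.factorial_ne_zero
  have h1 : (k.factorial : ℂ) * Ring.choose (a + k - 1) k = (ascPochhammer ℂ k).eval a := by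
    have := Ring.factorial_nsmul_multichoose_eq_ascPochhammer a k
    rw [Polynomial.ascPochhammer_smeval_eq_eval, nsmul_eq_mul] at this
    rw [← this, Ring.choose]
    congr 2
    ring
  have h2 : (ascPochhammer ℂ k).eval 1 = k.factorial := by
    simp [ascPochhammer_eval_one]
  simp only [hypTerm, h2, ← h1, FormalMultilinearSeries.ofScalars_apply_eq, smul_eq_mul]
  field_simp

lemma betaIntegral_add_natCast {b d : ℂ} (hb : 0 < b.re) (hd : 0 < d.re) (k : ℕ) :
    Complex.betaIntegral (b + k) d = (ascPochhammer ℂ k).eval b / (ascPochhammer ℂ k).eval (b + d) *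
      (Complex.Gamma b * Complex.Gamma d / Complex.Gamma (b + d)) := by
  have aux {u : ℂ} (hu : 0 < u.re) (j : ℕ) : u ≠ -j := by
    rintro rfl
    simp only [Complex.neg_re, Complex.natCast_re] at hu
    have : (0 : ℝ) ≤ j := j.cast_nonneg
    linarith
  have hbd : 0 < (b + d).re := by simpa using add_pos hb hd
  have hbk : 0 < (b + k).re := by simpa using add_pos_of_pos_of_nonneg hb k.cast_nonneg
  have hbdk : 0 < (b + d + k).re := by simpa using add_pos_of_pos_of_nonneg hbd k.cast_nonneg
  have h := Complex.Gamma_mul_Gamma_eq_betaIntegral hbk hd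
  rw [show b + k + d = b + d + k by ring] at h
  have h1 := Complex.Gamma_ne_zero_of_re_pos hbdk
  have h2 := Complex.Gamma_ne_zero_of_re_pos hbd
  have h3 := Complex.Gamma_ne_zero_of_re_pos hb
  rw [← Complex.Gamma_add_nat_div_Gamma_eq _ (aux hb), ← Complex.Gamma_add_nat_div_Gamma_eq _
    (aux hbd), eq_div_of_mul_eq h1 ((mul_comm _ _).trans h.symm)]
  field_simp

theorem integral_euler_eq_hypSum {b d : ℂ} (a : ℂ) (hb : 0 < b.re) (hd : 0 < d.re) {z : ℂ}
    (hz : ‖z‖ < 1) :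
    ∫ t in (0 : ℝ)..1, (t : ℂ) ^ (b - 1) * (1 - (t : ℂ)) ^ (d - 1) * (1 - z * t) ^ (-a) =
      Complex.Gamma b * Complex.Gamma d / Complex.Gamma (b + d) * hypSum a b (b + d) z := by
  set w : ℝ → ℂ := fun t => (t : ℂ) ^ (b - 1) * (1 - (t : ℂ)) ^ (d - 1) with hw
  have hwint : IntervalIntegrable w MeasureTheory.volume 0 1 :=
    Complex.betaIntegral_convergent hb hd
  have hone : ∀ k : ℕ, (1 : ℂ) ≠ -k := fun k h => by
    have := congr_arg Complex.re h
    simp only [Complex.one_re, Complex.neg_re, Complex.natCast_re] at this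
    have : (0 : ℝ) ≤ k := k.cast_nonneg
    linarith
  have hsum := summable_norm_hypTerm (a := a) (b := 1) hone hz
  have hnorm {t : ℝ} (ht : t ∈ Set.uIoc (0 : ℝ) 1) : ‖(t : ℂ)‖ ≤ 1 := by
    rw [Set.uIoc_of_le zero_le_one] at ht
    rw [Complex.norm_real, Real.norm_of_nonneg ht.1.le]
    exact ht.2
  have hlim := intervalIntegral.hasSum_integral_of_dominated_convergence (a := 0) (b := 1)
    (μ := MeasureTheory.volume) (F := fun (k : ℕ) t => w t * hypTerm a 1 1 (z * t) k)
    (f := fun t => w t * (1 - z * t) ^ (-a))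
    (fun (k : ℕ) t => ‖w t‖ * ‖hypTerm a 1 1 z k‖) ?_ ?_ ?_ ?_ ?_
  · have hc : ∀ k : ℕ, b + d ≠ -k := fun k h => by
      have := congr_arg Complex.re h
      simp only [Complex.add_re, Complex.neg_re, Complex.natCast_re] at this
      have : (0 : ℝ) ≤ k := k.cast_nonneg
      linarith
    refine hlim.unique ?_
    convert! (hasSum_hypTerm (a := a) (b := b) hc hz).mul_left
      (Complex.Gamma b * Complex.Gamma d / Complex.Gamma (b + d)) using 1
    funext k
    have : ∫ t in (0 : ℝ)..1, w t * hypTerm a 1 1 (z * t) k =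
        ∫ t in (0 : ℝ)..1, hypTerm a 1 1 z k *
          ((t : ℂ) ^ (b + k - 1) * (1 - (t : ℂ)) ^ (d - 1)) := by
      refine intervalIntegral.integral_congr_ae (Eventually.of_forall fun t ht => ?_)
      rw [Set.uIoc_of_le zero_le_one] at ht
      have ht0 : (t : ℂ) ≠ 0 := by exact_mod_cast ht.1.ne'
      rw [hypTerm_eq_mul_pow, hypTerm_eq_mul_pow _ _ _ z, hw,
        show b + k - 1 = b - 1 + k by ring, Complex.cpow_add _ _ ht0, Complex.cpow_natCast]
      ring
    rw [this, intervalIntegral.integral_const_mul, ← Complex.betaIntegral,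
      betaIntegral_add_natCast hb hd]
    have hk : (ascPochhammer ℂ k).eval 1 ≠ 0 := ascPochhammer_eval_ne_zero hone k
    simp only [hypTerm]
    field_simp
  · intro k
    refine (hwint.def'.aestronglyMeasurable).mul (Continuous.aestronglyMeasurable ?_)
    simp only [hypTerm]
    fun_prop
  · refine fun k => Eventually.of_forall fun t ht => ?_
    have : ‖hypTerm a 1 1 (z * t) k‖ ≤ ‖hypTerm a 1 1 z k‖ := by
      rw [hypTerm_eq_mul_pow, hypTerm_eq_mul_pow _ _ _ z, norm_mul, norm_mul, norm_pow, norm_pow,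
        norm_mul]
      gcongr
      exact mul_le_of_le_one_right (norm_nonneg _) (hnorm ht)
    rw [norm_mul (w t)]
    gcongr
  · exact Eventually.of_forall fun t _ => hsum.mul_left _
  · simp_rw [tsum_mul_left]
    exact hwint.norm.mul_const _
  · refine Eventually.of_forall fun t ht => (hasSum_one_sub_cpow_neg a ?_).mul_left _
    rw [norm_mul]
    exact (mul_le_of_le_one_right (norm_nonneg _) (hnorm ht)).trans_lt hz

end EulerIntegral

section Analyticity

lemma one_sub_mul_ofReal_mem_slitPlane {z : ℂ} (hz : 1 - z ∈ Complex.slitPlane) {t : ℝ}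
    (ht : t ∈ Set.Icc (0 : ℝ) 1) : 1 - z * t ∈ Complex.slitPlane := by
  have := Complex.starConvex_one_slitPlane hz (sub_nonneg.2 ht.2) ht.1 (sub_add_cancel 1 t)
  convert! this using 1
  simp only [Complex.real_smul]
  push_cast
  ring

lemma continuousOn_one_sub_mul_cpow {K : Set ℂ} (hK : ∀ z ∈ K, 1 - z ∈ Complex.slitPlane) (c : ℂ) :
    ContinuousOn (fun p : ℂ × ℝ => (1 - p.1 * p.2) ^ c) (K ×ˢ Set.Icc (0 : ℝ) 1) := by
  have h : ContinuousOn (fun p : ℂ × ℝ => 1 - p.1 * (p.2 : ℂ)) (K ×ˢ Set.Icc (0 : ℝ) 1) := by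
    fun_prop
  exact h.cpow continuousOn_const fun p hp => one_sub_mul_ofReal_mem_slitPlane (hK _ hp.1) hp.2

lemma differentiableOn_integral_mul_one_sub_cpow {w : ℝ → ℂ}
    (hw : IntervalIntegrable w MeasureTheory.volume 0 1) (e : ℂ) :
    DifferentiableOn ℂ (fun z => ∫ t in (0 : ℝ)..1, w t * (1 - z * t) ^ e)
      {z | 1 - z ∈ Complex.slitPlane} := by
  have hopen : IsOpen {z : ℂ | 1 - z ∈ Complex.slitPlane} :=
    Complex.isOpen_slitPlane.preimage (by fun_prop)
  intro z₀ hz₀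
  obtain ⟨r, hr, hball⟩ := Metric.nhds_basis_closedBall.mem_iff.1 (hopen.mem_nhds hz₀)
  have hcont (c : ℂ) : ContinuousOn (fun p : ℂ × ℝ => (1 - p.1 * p.2) ^ c)
      (Metric.closedBall z₀ r ×ˢ Set.Icc (0 : ℝ) 1) :=
    continuousOn_one_sub_mul_cpow hball c
  have hcont' (c z : ℂ) (hz : z ∈ Metric.closedBall z₀ r) :
      ContinuousOn (fun t : ℝ => (1 - z * t) ^ c) (Set.Icc 0 1) :=
    (by fun_prop : ContinuousOn (fun t : ℝ => 1 - z * (t : ℂ)) _).cpow continuousOn_const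
      fun t ht => one_sub_mul_ofReal_mem_slitPlane (hball hz) ht
  obtain ⟨C, hC⟩ := ((isCompact_closedBall z₀ r).prod isCompact_Icc).exists_bound_of_continuousOn
    (f := fun p : ℂ × ℝ => e * (1 - p.1 * p.2) ^ (e - 1) * -(p.2 : ℂ))
    (((hcont (e - 1)).const_mul e).mul (by fun_prop))
  have hsub : Set.uIoc (0 : ℝ) 1 ⊆ Set.Icc 0 1 := by
    rw [Set.uIoc_of_le zero_le_one]
    exact Set.Ioc_subset_Icc_self
  have hmeas (c z : ℂ) (hz : z ∈ Metric.closedBall z₀ r) :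
      MeasureTheory.AEStronglyMeasurable (fun t : ℝ => (1 - z * t) ^ c)
        (MeasureTheory.volume.restrict (Set.uIoc 0 1)) :=
    ((hcont' c z hz).mono hsub).aestronglyMeasurable measurableSet_uIoc
  have hwm := hw.def'.aestronglyMeasurable
  have hz₀r : z₀ ∈ Metric.closedBall z₀ r := Metric.mem_closedBall_self hr.le
  refine (intervalIntegral.hasDerivAt_integral_of_dominated_loc_of_deriv_le
    (F' := fun z t => w t * (e * (1 - z * t) ^ (e - 1) * -(t : ℂ)))
    (bound := fun t => ‖w t‖ * C) (Metric.closedBall_mem_nhds z₀ hr) ?_ ?_ ?_ ?_ ?_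
    ?_).2.differentiableAt.differentiableWithinAt
  · filter_upwards [Metric.closedBall_mem_nhds z₀ hr] with z hz
    exact hwm.mul (hmeas e z hz)
  · exact hw.mul_continuousOn (by simpa using hcont' e z₀ hz₀r)
  · exact hwm.mul (((hmeas (e - 1) z₀ hz₀r).const_mul e).mul
      (by fun_prop : Continuous fun t : ℝ => -(t : ℂ)).aestronglyMeasurable)
  · refine Eventually.of_forall fun t ht z hz => ?_
    rw [norm_mul (w t)]
    gcongr
    exact hC (z, t) ⟨hz, hsub ht⟩
  · exact hw.norm.mul_const C
  · refine Eventually.of_forall fun t ht z hz => HasDerivAt.const_mul _ ?_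
    have h : HasDerivAt (fun z : ℂ => 1 - z * t) (-(t : ℂ)) z := by
      simpa using ((hasDerivAt_id z).mul_const (t : ℂ)).const_sub 1
    exact h.cpow_const (one_sub_mul_ofReal_mem_slitPlane (hball hz) (hsub ht))

lemma isPreconnected_setOf_one_sub_mem :
    IsPreconnected {z : ℂ | ‖1 - z‖ < 1 ∧ 1 - z ∈ Complex.slitPlane} := by
  have hhalf : (1 / 2 : ℂ) ∈ {z : ℂ | ‖1 - z‖ < 1 ∧ 1 - z ∈ Complex.slitPlane} := by
    refine ⟨?_, Or.inl ?_⟩ <;> norm_num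
  have hstar : StarConvex ℝ (1 / 2 : ℂ) {z : ℂ | ‖1 - z‖ < 1 ∧ 1 - z ∈ Complex.slitPlane} := by
    intro z hz a b ha hb hab
    have heq : (1 : ℂ) - (a • (1 / 2 : ℂ) + b • z) = a * (1 / 2) + b * (1 - z) := by
      have : (a : ℂ) + b = 1 := by exact_mod_cast hab
      simp only [Complex.real_smul]
      linear_combination -this
    simp only [Set.mem_ofPred_eq, heq]
    constructor
    · calc ‖(a * (1 / 2) + b * (1 - z) : ℂ)‖ ≤ ‖(a * (1 / 2) : ℂ)‖ + ‖(b * (1 - z) : ℂ)‖ :=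
            norm_add_le _ _
        _ = a * (1 / 2) + b * ‖1 - z‖ := by
            simp [abs_of_nonneg ha, abs_of_nonneg hb]
        _ < 1 := by
            rcases hb.eq_or_lt with rfl | hb'
            · linarith
            · nlinarith [mul_lt_mul_of_pos_left hz.1 hb']
    · rcases ha.eq_or_lt with rfl | ha'
      · rw [zero_add] at hab
        simpa [hab] using hz.2
      · rcases hz.2 with h | h
        · left
          simp only [Complex.add_re, Complex.re_ofReal_mul]
          have := mul_nonneg hb h.le
          rw [Complex.sub_re, Complex.one_re] at this
          norm_num
          linarith
        · rcases hb.eq_or_lt with rfl | hb'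
          · left
            simpa using ha'
          · right
            simpa using ⟨hb'.ne', by simpa using h⟩
  exact (hstar.isPathConnected hhalf).isConnected.isPreconnected

end Analyticity

section BoundaryValues

lemma exp_log_add_mul_eq {y : ℝ} (hy : 0 < y) (c : ℝ) (w : ℂ) :
    Complex.exp ((Real.log y + w) * c) = Complex.exp (w * c) * (y ^ c : ℝ) := by
  rw [Real.rpow_def_of_pos hy, Complex.ofReal_exp, ← Complex.exp_add]
  congr 1
  push_cast
  ring

lemma tendsto_neg_sub_mul_I_cpow {y : ℝ} (hy : 0 < y) (c : ℝ) :
    Tendsto (fun ε : ℝ => (-y - ε * Complex.I : ℂ) ^ (c : ℂ)) (𝓝[>] 0)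
      (𝓝 (Complex.exp (-Real.pi * Complex.I * c) * (y ^ c : ℝ))) := by
  have hlog := Complex.tendsto_log_nhdsWithin_im_neg_of_re_neg_of_im_zero (z := -y)
    (by simpa using hy) (by simp)
  rw [norm_neg, Complex.norm_real, Real.norm_of_nonneg hy.le, sub_eq_add_neg] at hlog
  have hpath : Tendsto (fun ε : ℝ => (-y - ε * Complex.I : ℂ)) (𝓝[>] 0)
      (𝓝[{z : ℂ | z.im < 0}] (-y : ℂ)) := by
    refine tendsto_nhdsWithin_iff.2 ⟨?_, ?_⟩
    · have : Continuous fun ε : ℝ => (-y - ε * Complex.I : ℂ) := by fun_prop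
      simpa using (this.tendsto 0).mono_left nhdsWithin_le_nhds
    · filter_upwards [self_mem_nhdsWithin] with ε hε
      simpa using hε
  have h := (Complex.continuous_exp.tendsto _).comp ((hlog.comp hpath).mul_const (c : ℂ))
  rw [exp_log_add_mul_eq hy, ← neg_mul] at h
  refine h.congr' ?_
  filter_upwards [self_mem_nhdsWithin] with ε hε
  rw [Function.comp_apply, Function.comp_apply, Complex.cpow_def_of_ne_zero]
  intro h0
  have := congr_arg Complex.re h0
  simp at this
  linarith

lemma tendsto_neg_add_mul_I_cpow {y : ℝ} (hy : 0 < y) (c : ℝ) :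
    Tendsto (fun ε : ℝ => (-y + ε * Complex.I : ℂ) ^ (c : ℂ)) (𝓝[>] 0)
      (𝓝 (Complex.exp (Real.pi * Complex.I * c) * (y ^ c : ℝ))) := by
  have hlog := Complex.tendsto_log_nhdsWithin_im_nonneg_of_re_neg_of_im_zero (z := -y)
    (by simpa using hy) (by simp)
  rw [norm_neg, Complex.norm_real, Real.norm_of_nonneg hy.le] at hlog
  have hpath : Tendsto (fun ε : ℝ => (-y + ε * Complex.I : ℂ)) (𝓝[>] 0)
      (𝓝[{z : ℂ | 0 ≤ z.im}] (-y : ℂ)) := by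
    refine tendsto_nhdsWithin_iff.2 ⟨?_, ?_⟩
    · have : Continuous fun ε : ℝ => (-y + ε * Complex.I : ℂ) := by fun_prop
      simpa using (this.tendsto 0).mono_left nhdsWithin_le_nhds
    · filter_upwards [self_mem_nhdsWithin] with ε hε
      simpa using (Set.mem_Ioi.1 hε).le
  have h := (Complex.continuous_exp.tendsto _).comp ((hlog.comp hpath).mul_const (c : ℂ))
  rw [exp_log_add_mul_eq hy] at h
  refine h.congr' ?_
  filter_upwards [self_mem_nhdsWithin] with ε hε
  rw [Function.comp_apply, Function.comp_apply, Complex.cpow_def_of_ne_zero]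
  intro h0
  have := congr_arg Complex.re h0
  simp at this
  linarith

lemma Flam_two_mul_add_one (m : ℕ) (lam z : ℂ) :
    Flam (2 * m + 1) lam z =
      Complex.Gamma (m + 1 / 2) / (Complex.Gamma (m - lam) * Complex.Gamma (1 / 2 + lam)) *
        ∫ t in (0 : ℝ)..1, (t : ℂ) ^ (m - lam - 1) * (1 - (t : ℂ)) ^ (1 / 2 + lam - 1) *
          (1 - z * t) ^ (-(m + lam)) := by
  have h1 : ((2 * m + 1 : ℕ) : ℂ) / 2 = m + 1 / 2 := by push_cast; ring
  have h2 : (((2 * m + 1 : ℕ) : ℂ) - 1) / 2 = m := by push_cast; ring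
  rw [Flam, h1, h2, show lam - 1 / 2 = 1 / 2 + lam - 1 by ring,
    show -(m : ℂ) - lam = -(m + lam) by ring]

lemma Flam_eq_hypSum {m : ℕ} {lam z : ℂ} (hb : 0 < (m - lam : ℂ).re) (hd : 0 < (1 / 2 + lam).re)
    (hz : ‖z‖ < 1) : Flam (2 * m + 1) lam z = hypSum (m + lam) (m - lam) (m + 1 / 2) z := by
  have hc : (m - lam + (1 / 2 + lam) : ℂ) = m + 1 / 2 := by ring
  have h1 := Complex.Gamma_ne_zero_of_re_pos hb
  have h2 := Complex.Gamma_ne_zero_of_re_pos hd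
  have h3 : Complex.Gamma (m + 1 / 2) ≠ 0 := Complex.Gamma_ne_zero (natCast_add_half_ne_neg_nat m)
  rw [Flam_two_mul_add_one, integral_euler_eq_hypSum _ hb hd hz, hc]
  generalize Complex.Gamma (m - lam) = A at *
  generalize Complex.Gamma (1 / 2 + lam) = B at *
  generalize Complex.Gamma (m + 1 / 2) = C at *
  generalize hypSum (m + lam) (m - lam) (m + 1 / 2) z = H
  field_simp

lemma Flam_eq_hypConnection {m : ℕ} {lam z : ℂ} (hb : 0 < (m - lam : ℂ).re)
    (hd : 0 < (1 / 2 + lam).re) (hz : ‖1 - z‖ < 1) (hs : 1 - z ∈ Complex.slitPlane) :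
    Flam (2 * m + 1) lam z = hypConnection m lam z := by
  set D : Set ℂ := {z : ℂ | ‖1 - z‖ < 1 ∧ 1 - z ∈ Complex.slitPlane} with hD
  have hopen : IsOpen D :=
    (isOpen_lt (by fun_prop : Continuous fun z : ℂ => ‖1 - z‖) continuous_const).inter
      (Complex.isOpen_slitPlane.preimage (by fun_prop : Continuous fun z : ℂ => 1 - z))
  have hF : AnalyticOnNhd ℂ (Flam (2 * m + 1) lam) D := by
    refine DifferentiableOn.analyticOnNhd ?_ hopen
    have := (differentiableOn_integral_mul_one_sub_cpow
      (Complex.betaIntegral_convergent hb hd) (-(m + lam))).const_mul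
      (Complex.Gamma (m + 1 / 2) / (Complex.Gamma (m - lam) * Complex.Gamma (1 / 2 + lam)))
    exact (this.mono fun z hz => hz.2).congr fun z _ => Flam_two_mul_add_one m lam z
  have hG : AnalyticOnNhd ℂ (hypConnection m lam) D := by
    refine DifferentiableOn.analyticOnNhd (fun z hz => ?_) hopen
    have hsub : DifferentiableAt ℂ (fun z : ℂ => 1 - z) z := by fun_prop
    have d1 := (hasDerivAt_hypSum (a := m + lam) (b := m - lam)
      (natCast_add_half_ne_neg_nat m) hz.1).differentiableAt.comp z hsub
    have d2 := (hasDerivAt_hypSum (a := 1 / 2 - lam) (b := 1 / 2 + lam)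
      (three_halves_sub_natCast_ne_neg_nat m) hz.1).differentiableAt.comp z hsub
    have d3 := hsub.cpow_const (c := (1 / 2 - m : ℂ)) hz.2
    exact ((d1.const_mul _).add ((d3.mul d2).const_mul _)).differentiableWithinAt
  have hhalf : ((1 / 2 : ℝ) : ℂ) ∈ D := by
    refine ⟨?_, Or.inl ?_⟩ <;> norm_num
  refine hF.eqOn_of_preconnected_of_frequently_eq hG isPreconnected_setOf_one_sub_mem hhalf ?_
    ⟨hz, hs⟩
  have htend : Tendsto ((↑) : ℝ → ℂ) (𝓝[≠] (1 / 2)) (𝓝[≠] ((1 / 2 : ℝ) : ℂ)) :=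
    Complex.continuous_ofReal.continuousAt.continuousWithinAt.tendsto_nhdsWithin
      fun y hy h => hy (Complex.ofReal_injective h)
  refine htend.frequently (Eventually.frequently ?_)
  filter_upwards [mem_nhdsWithin_of_mem_nhds (Ioo_mem_nhds (a := (0 : ℝ)) (b := 1) (x := 1 / 2)
    (by norm_num) (by norm_num))] with y hy
  rw [Flam_eq_hypSum hb hd (norm_ofReal_lt_one hy.1 hy.2),
    hypSum_eq_hypConnection m lam hy.1 hy.2]

end BoundaryValues

section Limits

lemma bval_two_mul_add_one (m : ℕ) (lam : ℂ) (x s : ℝ) :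
    bval (2 * m + 1) lam x s =
      Complex.Gamma (m + 1 / 2) * Complex.Gamma (1 / 2 - m) *
          ((Complex.Gamma (1 / 2 + lam))⁻¹ * (Complex.Gamma (1 / 2 - lam))⁻¹) *
          hypSum (m + lam) (m - lam) (m + 1 / 2) (1 - x) +
        Complex.Gamma (m + 1 / 2) * Complex.Gamma (m - 1 / 2) *
          ((Complex.Gamma (m + lam))⁻¹ * (Complex.Gamma (m - lam))⁻¹) *
          (Complex.exp (s * Real.pi * Complex.I * (1 / 2 - m : ℝ)) *
            ((x - 1) ^ (1 / 2 - m : ℝ) : ℝ) *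
            hypSum (1 / 2 - lam) (1 / 2 + lam) (3 / 2 - m) (1 - x)) := by
  have h1 : ((2 * m + 1 : ℕ) : ℂ) / 2 = m + 1 / 2 := by push_cast; ring
  have h2 : (((2 * m + 1 : ℕ) : ℂ) - 1) / 2 = m := by push_cast; ring
  have h3 : (2 - ((2 * m + 1 : ℕ) : ℂ)) / 2 = 1 / 2 - m := by push_cast; ring
  have h4 : (4 - ((2 * m + 1 : ℕ) : ℂ)) / 2 = 3 / 2 - m := by push_cast; ring
  have h5 : (((2 * m + 1 : ℕ) : ℂ) - 2) / 2 = m - 1 / 2 := by push_cast; ring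
  have h6 : (2 - ((2 * m + 1 : ℕ) : ℝ)) / 2 = 1 / 2 - m := by push_cast; ring
  have h7 : ((1 / 2 - m : ℝ) : ℂ) = 1 / 2 - m := by push_cast; ring
  rw [bval, h1, h2, h3, h4, h5, h6, h7]
  simp only [hypSum, div_eq_mul_inv, mul_inv]
  ring

lemma tendsto_hypConnection {m : ℕ} {lam L : ℂ} {x : ℝ} (hx : ‖(1 - x : ℂ)‖ < 1) {p : ℝ → ℂ}
    (hp : Tendsto p (𝓝[>] 0) (𝓝 x))
    (hL : Tendsto (fun ε => (1 - p ε) ^ (1 / 2 - m : ℂ)) (𝓝[>] 0) (𝓝 L)) :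
    Tendsto (fun ε => hypConnection m lam (p ε)) (𝓝[>] 0)
      (𝓝 (Complex.Gamma (m + 1 / 2) * Complex.Gamma (1 / 2 - m) *
          ((Complex.Gamma (1 / 2 + lam))⁻¹ * (Complex.Gamma (1 / 2 - lam))⁻¹) *
          hypSum (m + lam) (m - lam) (m + 1 / 2) (1 - x) +
        Complex.Gamma (m + 1 / 2) * Complex.Gamma (m - 1 / 2) *
          ((Complex.Gamma (m + lam))⁻¹ * (Complex.Gamma (m - lam))⁻¹) *
          (L * hypSum (1 / 2 - lam) (1 / 2 + lam) (3 / 2 - m) (1 - x)))) := by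
  have hp' : Tendsto (fun ε => 1 - p ε) (𝓝[>] 0) (𝓝 (1 - x : ℂ)) := hp.const_sub 1
  have h1 := (hasDerivAt_hypSum (a := m + lam) (b := m - lam)
    (natCast_add_half_ne_neg_nat m) hx).continuousAt.tendsto.comp hp'
  have h2 := (hasDerivAt_hypSum (a := 1 / 2 - lam) (b := 1 / 2 + lam)
    (three_halves_sub_natCast_ne_neg_nat m) hx).continuousAt.tendsto.comp hp'
  exact (h1.const_mul _).add ((hL.mul h2).const_mul _)

lemma tendsto_Flam {m : ℕ} {lam : ℂ} (hb : 0 < (m - lam : ℂ).re) (hd : 0 < (1 / 2 + lam).re)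
    {x s : ℝ} (hx : ‖(1 - x : ℂ)‖ < 1) {p : ℝ → ℂ} (hp : Tendsto p (𝓝[>] 0) (𝓝 x))
    (him : ∀ ε > 0, (p ε).im ≠ 0)
    (hL : Tendsto (fun ε => (1 - p ε) ^ ((1 / 2 - m : ℝ) : ℂ)) (𝓝[>] 0)
      (𝓝 (Complex.exp (s * Real.pi * Complex.I * (1 / 2 - m : ℝ)) *
        ((x - 1) ^ (1 / 2 - m : ℝ) : ℝ)))) :
    Tendsto (fun ε => Flam (2 * m + 1) lam (p ε)) (𝓝[>] 0) (𝓝 (bval (2 * m + 1) lam x s)) := by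
  rw [bval_two_mul_add_one]
  have hcast : ((1 / 2 - m : ℝ) : ℂ) = 1 / 2 - m := by push_cast; ring
  refine (tendsto_hypConnection (lam := lam) hx hp (by simpa only [hcast] using hL)).congr' ?_
  have hnorm : ∀ᶠ ε in 𝓝[>] 0, ‖1 - p ε‖ < 1 := (hp.const_sub 1).norm.eventually_lt_const hx
  filter_upwards [hnorm, self_mem_nhdsWithin] with ε hε hpos
  exact (Flam_eq_hypConnection hb hd hε (Or.inr (by simpa using him ε hpos))).symm

end Limits

open Filter Topology in
theorem stmt12 (n : ℕ) (hn : 3 ≤ n) (hodd : Odd n) (lam : ℂ) (hlam : admissible n lam)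
    (x : ℝ) (hx1 : 1 < x) (hx2 : x < 2) :
    Summable (hypTerm (((n : ℂ) - 1)/2 + lam) (((n : ℂ) - 1)/2 - lam) ((n : ℂ)/2)
      ((1 : ℂ) - x)) ∧
    Summable (hypTerm (1/2 - lam) (1/2 + lam) ((4 - (n : ℂ))/2) ((1 : ℂ) - x)) ∧
    Tendsto (fun ε : ℝ => Flam n lam ((x : ℂ) + (ε : ℂ) * Complex.I)) (𝓝[>] (0 : ℝ))
      (𝓝 (bval n lam x (-1))) ∧
    Tendsto (fun ε : ℝ => Flam n lam ((x : ℂ) - (ε : ℂ) * Complex.I)) (𝓝[>] (0 : ℝ))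
      (𝓝 (bval n lam x 1)) := by
  obtain ⟨m, rfl⟩ := hodd
  have hm : (1 : ℝ) ≤ m := by exact_mod_cast (by omega : 1 ≤ m)
  have hx : ‖(1 - x : ℂ)‖ < 1 := by
    rw [← Complex.ofReal_one, ← Complex.ofReal_sub, Complex.norm_real, Real.norm_eq_abs, abs_lt]
    constructor <;> linarith
  have hre : 0 ≤ lam.re ∧ lam.re < m := by
    rcases hlam with ⟨h, -⟩ | ⟨-, h0, h⟩
    · rw [h]
      exact ⟨le_rfl, by linarith⟩
    · push_cast at h
      exact ⟨h0.le, by linarith⟩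
  have hb : 0 < (m - lam : ℂ).re := by simpa using hre.2
  have hd : 0 < (1 / 2 + lam).re := by
    rw [Complex.add_re]
    norm_num
    linarith [hre.1]
  refine ⟨summable_hypTerm (fun k => ?_) hx, summable_hypTerm (fun k => ?_) hx,
    tendsto_Flam hb hd hx ?_ (fun ε hε => ?_) ?_, tendsto_Flam hb hd hx ?_ (fun ε hε => ?_) ?_⟩
  · convert natCast_add_half_ne_neg_nat m k using 1
    push_cast
    ring
  · convert three_halves_sub_natCast_ne_neg_nat m k using 1
    push_cast
    ring
  · have : Continuous fun ε : ℝ => (x + ε * Complex.I : ℂ) := by fun_prop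
    simpa using (this.tendsto 0).mono_left nhdsWithin_le_nhds
  · simpa using hε.ne'
  · have h := tendsto_neg_sub_mul_I_cpow (sub_pos.2 hx1) (1 / 2 - m)
    push_cast at h ⊢
    convert! h using 3
    all_goals ring_nf
  · have : Continuous fun ε : ℝ => (x - ε * Complex.I : ℂ) := by fun_prop
    simpa using (this.tendsto 0).mono_left nhdsWithin_le_nhds
  · simpa using hε.ne'
  · have h := tendsto_neg_add_mul_I_cpow (sub_pos.2 hx1) (1 / 2 - m)
    push_cast at h ⊢
    convert! h using 3
    all_goals ring_nf
end

section
/- Let n = 2, so ρ = 1/2, and let λ be either purely imaginary with nonnegative imaginary part or real with 0 < λ < 1/2. Then F_λ(z) behaves like a logarithm near z = 1: the quotient F_λ(z) / (−Log(1−z)) tends to 1/(Γ(1/2+λ)Γ(1/2−λ)) as z → 1 within ℂ∖[1,∞), where Log denotes the principal branch of the complex logarithm. -/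
open scoped BigOperators
open Filter Topology

open MeasureTheory intervalIntegral in
/-- Integrability and norm bound from an integrable majorant valid away from a single point. -/
lemma intervalIntegrable_and_norm_integral_le {f : ℝ → ℂ} {k : ℝ → ℝ} {a b p : ℝ}
    (hab : a ≤ b) (hf : Measurable f) (hk : IntervalIntegrable k volume a b)
    (h : ∀ x, a < x → x ≤ b → x ≠ p → ‖f x‖ ≤ k x) :
    IntervalIntegrable f volume a b ∧ ‖∫ x in a..b, f x‖ ≤ ∫ x in a..b, k x := by
  have hne : ∀ᵐ x : ℝ, x ≠ p := by
    simp [ae_iff, measure_singleton]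
  constructor
  · refine hk.mono_fun' hf.aestronglyMeasurable ?_
    rw [Filter.EventuallyLE, ae_restrict_iff' measurableSet_uIoc]
    filter_upwards [hne] with x hx hx'
    rw [Set.uIoc_of_le hab] at hx'
    exact h x hx'.1 hx'.2 hx
  · refine norm_integral_le_of_norm_le hab ?_ hk
    filter_upwards [hne] with x hx hx'
    exact h x hx'.1 hx'.2 hx

lemma norm_cpow_neg_le {a : ℂ} (ha : a.re ≠ 0) (z : ℂ) :
    ‖z ^ (-a)‖ ≤ Real.exp (Real.pi * |a.im|) * ‖z‖ ^ (-a.re) := by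
  rw [Complex.norm_cpow_of_imp (fun _ h => absurd h (by simpa using ha)), div_eq_mul_inv,
    ← Real.exp_neg, mul_comm, Complex.neg_re]
  gcongr
  calc -(z.arg * (-a).im) = z.arg * a.im := by simp
    _ ≤ |z.arg| * |a.im| := by rw [← abs_mul]; exact le_abs_self _
    _ ≤ _ := by gcongr; exact Complex.abs_arg_le_pi z

lemma intervalIntegrable_abs_rpow {r : ℝ} (hr : -1 < r) (a b : ℝ) :
    IntervalIntegrable (fun x : ℝ => |x| ^ r) MeasureTheory.volume a b := by
  have h := (intervalIntegral.intervalIntegrable_cpow' (a := a) (b := b) (r := (r : ℂ))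
    (by simpa using hr)).norm
  refine h.congr_ae ?_
  refine MeasureTheory.ae_restrict_of_ae ?_
  have hne : ∀ᵐ x : ℝ, x ≠ 0 := by
    simp [MeasureTheory.ae_iff, MeasureTheory.measure_singleton]
  filter_upwards [hne] with x hx
  rw [Complex.norm_cpow_of_ne_zero (by exact_mod_cast hx)]
  simp

/-- The homogeneous kernel of degree `-1` with singularities at `0` and `p`. -/
lemma intervalIntegrable_rpow_mul_abs_sub_rpow {α p : ℝ} (h0 : 0 < α) (h1 : α < 1) (hp : 0 < p)
    {b : ℝ} (hb : 0 ≤ b) :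
    IntervalIntegrable (fun s : ℝ => s ^ (α - 1) * |s - p| ^ (-α)) MeasureTheory.volume 0 b := by
  have hi1 := (intervalIntegral.intervalIntegrable_rpow' (a := 0) (b := b) (r := α - 1)
    (by linarith)).mul_const ((p / 2) ^ (-α))
  have hi2 := ((intervalIntegrable_abs_rpow (r := -α) (by linarith) (0 - p)
    (b - p)).comp_sub_right p).const_mul ((p / 2) ^ (α - 1))
  simp only [sub_add_cancel] at hi2
  refine (hi1.add hi2).mono_fun' (by fun_prop) ?_
  rw [Filter.EventuallyLE, MeasureTheory.ae_restrict_iff' measurableSet_uIoc]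
  refine .of_forall fun s hs => ?_
  rw [Set.uIoc_of_le hb] at hs
  have hs0 := hs.1
  rw [Real.norm_of_nonneg (by positivity)]
  rcases le_total s (p / 2) with h | h
  · have : |s - p| ^ (-α) ≤ (p / 2) ^ (-α) :=
      Real.rpow_le_rpow_of_nonpos (by positivity) (by rw [abs_of_nonpos] <;> linarith)
        (by linarith)
    calc _ ≤ s ^ (α - 1) * (p / 2) ^ (-α) := by gcongr
      _ ≤ _ := by
        have : 0 ≤ (p / 2) ^ (α - 1) * |s - p| ^ (-α) := by positivity
        simpa using this
  · have : s ^ (α - 1) ≤ (p / 2) ^ (α - 1) :=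
      Real.rpow_le_rpow_of_nonpos (by positivity) h (by linarith)
    calc _ ≤ (p / 2) ^ (α - 1) * |s - p| ^ (-α) := by gcongr
      _ ≤ _ := by
        have : 0 ≤ s ^ (α - 1) * (p / 2) ^ (-α) := by positivity
        simpa using this

lemma integral_rpow_mul_abs_sub_rpow_scale {α p : ℝ} (hp : 0 < p) (b : ℝ) (hb : 0 ≤ b) :
    ∫ s in (0:ℝ)..(p * b), s ^ (α - 1) * |s - p| ^ (-α) =
      ∫ v in (0:ℝ)..b, v ^ (α - 1) * |v - 1| ^ (-α) := by
  have h := intervalIntegral.mul_integral_comp_mul_left (a := 0) (b := b) (c := p)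
    (f := fun s : ℝ => s ^ (α - 1) * |s - p| ^ (-α))
  rw [mul_zero] at h
  rw [← h, ← intervalIntegral.integral_const_mul]
  refine intervalIntegral.integral_congr fun v hv => ?_
  rw [Set.uIcc_of_le hb] at hv
  have e : p * v - p = p * (v - 1) := by ring
  simp only [e, abs_mul, abs_of_pos hp]
  rw [Real.mul_rpow hp.le hv.1, Real.mul_rpow hp.le (abs_nonneg _)]
  have : p * p ^ (α - 1) * p ^ (-α) = 1 := by
    nth_rewrite 1 [← Real.rpow_one p]
    rw [← Real.rpow_add hp, ← Real.rpow_add hp]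
    simp
  linear_combination (v ^ (α - 1) * |v - 1| ^ (-α)) * this

/-- The Euler integrand after `t = 1 - s`, `z = 1 - w`. -/
noncomputable def eulerKernel (a w : ℂ) (s : ℝ) : ℂ :=
  (1 - (s : ℂ)) ^ (-a) * (s : ℂ) ^ (a - 1) * ((s : ℂ) + w * (1 - s)) ^ (-a)

lemma measurable_eulerKernel (a w : ℂ) : Measurable (eulerKernel a w) := by
  unfold eulerKernel
  fun_prop

lemma norm_eulerKernel_le {a : ℂ} (h0 : 0 < a.re) (w : ℂ) {s : ℝ} (hs : 0 < s) (hs1 : s ≤ 1) :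
    ‖eulerKernel a w s‖ ≤ (Real.exp (Real.pi * |a.im|)) ^ 2 *
      ((1 - s) ^ (-a.re) * s ^ (a.re - 1) * ‖(s : ℂ) + w * (1 - s)‖ ^ (-a.re)) := by
  have e1 : ‖(1 : ℂ) - s‖ = 1 - s := by
    rw [← Complex.ofReal_one, ← Complex.ofReal_sub, Complex.norm_real, Real.norm_of_nonneg]
    linarith
  have b1 := norm_cpow_neg_le h0.ne' (1 - (s : ℂ))
  have b2 := norm_cpow_neg_le h0.ne' ((s : ℂ) + w * (1 - s))
  rw [e1] at b1
  have b3 : ‖(s : ℂ) ^ (a - 1)‖ = s ^ (a.re - 1) := by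
    rw [Complex.norm_cpow_eq_rpow_re_of_pos hs]; simp
  have : 0 ≤ 1 - s := by linarith
  rw [eulerKernel, norm_mul, norm_mul, b3]
  calc _ ≤ (Real.exp (Real.pi * |a.im|) * (1 - s) ^ (-a.re)) * s ^ (a.re - 1) *
        (Real.exp (Real.pi * |a.im|) * ‖(s : ℂ) + w * (1 - s)‖ ^ (-a.re)) := by gcongr
    _ = _ := by ring

lemma abs_sub_norm_mul_le (w : ℂ) {s : ℝ} (hs : 0 ≤ s) (hs1 : s ≤ 1) :
    |s - ‖w‖ * (1 - s)| ≤ ‖(s : ℂ) + w * (1 - s)‖ := by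
  have h := abs_norm_sub_norm_le (s : ℂ) (-(w * (1 - s)))
  rw [sub_neg_eq_add, norm_neg, norm_mul, Complex.norm_of_nonneg hs, ← Complex.ofReal_one,
    ← Complex.ofReal_sub, Complex.norm_of_nonneg (by linarith)] at h
  simpa using h

open MeasureTheory in
lemma eulerKernel_near {a : ℂ} (h0 : 0 < a.re) (h1 : a.re < 1) :
    ∃ C : ℝ, ∀ w : ℂ, w ≠ 0 → ‖w‖ ≤ 1 / 8 →
      IntervalIntegrable (eulerKernel a w) volume 0 (2 * ‖w‖) ∧
      ‖∫ s in (0:ℝ)..(2 * ‖w‖), eulerKernel a w s‖ ≤ C := by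
  set E := (Real.exp (Real.pi * |a.im|)) ^ 2 with hE
  have hE0 : 0 ≤ E := by positivity
  set D := E * (3 / 4 : ℝ) ^ (-a.re) with hD
  have hD0 : 0 ≤ D := by positivity
  refine ⟨D * ∫ v in (0:ℝ)..4, v ^ (a.re - 1) * |v - 1| ^ (-a.re), fun w hw hw8 => ?_⟩
  set r := ‖w‖ with hr
  have hr0 : 0 < r := norm_pos_iff.mpr hw
  set p := r / (1 + r) with hp
  have hp0 : 0 < p := by positivity
  have hp4 : 2 * r ≤ p * 4 := by
    rw [hp, div_mul_eq_mul_div, le_div_iff₀ (by positivity)]; nlinarith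
  have hint4 := intervalIntegrable_rpow_mul_abs_sub_rpow h0 h1 hp0 (b := p * 4) (by positivity)
  have hint2 := intervalIntegrable_rpow_mul_abs_sub_rpow h0 h1 hp0 (b := 2 * r) (by positivity)
  obtain ⟨hi, hle⟩ := intervalIntegrable_and_norm_integral_le (p := p) (a := 0) (b := 2 * r)
    (by positivity) (measurable_eulerKernel a w) (hint2.const_mul D) (fun s hs hs2 hsp => by
      have hs1 : s ≤ 1 / 4 := by linarith
      refine (norm_eulerKernel_le h0 w hs (by linarith)).trans ?_
      have hl : |s - p| ≤ ‖(s : ℂ) + w * (1 - s)‖ := by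
        refine le_trans ?_ (abs_sub_norm_mul_le w hs.le (by linarith))
        have : s - ‖w‖ * (1 - s) = (1 + r) * (s - p) := by
          rw [hp]; field_simp; ring
        rw [this, abs_mul, abs_of_pos (by linarith : 0 < 1 + r)]
        nlinarith [abs_nonneg (s - p)]
      have b1 : ‖(s : ℂ) + w * (1 - s)‖ ^ (-a.re) ≤ |s - p| ^ (-a.re) :=
        Real.rpow_le_rpow_of_nonpos (abs_pos.mpr (sub_ne_zero.mpr hsp)) hl (by linarith)
      have b2 : (1 - s) ^ (-a.re) ≤ (3 / 4 : ℝ) ^ (-a.re) :=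
        Real.rpow_le_rpow_of_nonpos (by norm_num) (by linarith) (by linarith)
      calc _ ≤ E * ((3 / 4 : ℝ) ^ (-a.re) * s ^ (a.re - 1) * |s - p| ^ (-a.re)) := by gcongr
        _ = _ := by rw [hD]; ring)
  refine ⟨hi, hle.trans ?_⟩
  rw [intervalIntegral.integral_const_mul]
  refine mul_le_mul_of_nonneg_left ?_ hD0
  rw [← integral_rpow_mul_abs_sub_rpow_scale hp0 4 (by norm_num)]
  refine intervalIntegral.integral_mono_interval le_rfl (by positivity) hp4 ?_ hint4
  filter_upwards [ae_restrict_mem measurableSet_Ioc] with s hs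
  have := hs.1
  simp only [Pi.zero_apply]
  positivity

open MeasureTheory in
lemma eulerKernel_far {a : ℂ} (h0 : 0 < a.re) (h1 : a.re < 1) :
    ∃ C : ℝ, ∀ w : ℂ, ‖w‖ ≤ 1 / 8 →
      IntervalIntegrable (eulerKernel a w) volume (1 / 4) 1 ∧
      ‖∫ s in (1 / 4 : ℝ)..1, eulerKernel a w s‖ ≤ C := by
  set E := (Real.exp (Real.pi * |a.im|)) ^ 2 with hE
  set D := E * ((1 / 4 : ℝ) ^ (a.re - 1) * (1 / 8 : ℝ) ^ (-a.re)) with hD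
  refine ⟨∫ s in (1 / 4 : ℝ)..1, D * |s - 1| ^ (-a.re), fun w hw8 => ?_⟩
  have hk := ((intervalIntegrable_abs_rpow (r := -a.re) (by linarith) (1 / 4 - 1)
    (1 - 1)).comp_sub_right 1).const_mul D
  simp only [sub_add_cancel] at hk
  refine intervalIntegrable_and_norm_integral_le (p := 1) (by norm_num)
    (measurable_eulerKernel a w) hk fun s hs hs1 hsp => ?_
  refine (norm_eulerKernel_le h0 w (by linarith) hs1).trans ?_
  have hl : 1 / 8 ≤ ‖(s : ℂ) + w * (1 - s)‖ := by
    refine le_trans ?_ ((le_abs_self _).trans (abs_sub_norm_mul_le w (by linarith) hs1))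
    nlinarith [norm_nonneg w]
  have b1 : ‖(s : ℂ) + w * (1 - s)‖ ^ (-a.re) ≤ (1 / 8 : ℝ) ^ (-a.re) :=
    Real.rpow_le_rpow_of_nonpos (by norm_num) hl (by linarith)
  have b2 : s ^ (a.re - 1) ≤ (1 / 4 : ℝ) ^ (a.re - 1) :=
    Real.rpow_le_rpow_of_nonpos (by norm_num) hs.le (by linarith)
  have b3 : |s - 1| = 1 - s := by rw [abs_of_nonpos] <;> linarith
  have b4 : 0 ≤ 1 - s := by linarith
  rw [b3]
  calc _ ≤ E * ((1 - s) ^ (-a.re) * (1 / 4 : ℝ) ^ (a.re - 1) * (1 / 8 : ℝ) ^ (-a.re)) := by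
        gcongr
    _ = _ := by rw [hD]; ring

lemma exists_norm_cpow_sub_one_le (b : ℂ) :
    ∃ C : ℝ, 0 ≤ C ∧ ∀ ζ : ℂ, ‖ζ - 1‖ ≤ 3 / 4 → ‖ζ ^ b - 1‖ ≤ C * ‖ζ - 1‖ := by
  have hsl : ∀ ζ ∈ Metric.closedBall (1 : ℂ) (3 / 4), ζ ∈ Complex.slitPlane := by
    intro ζ hζ
    rw [mem_closedBall_iff_norm] at hζ
    left
    have := (Complex.abs_re_le_norm (ζ - 1)).trans hζ
    rw [abs_le, Complex.sub_re, Complex.one_re] at this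
    linarith [this.1]
  obtain ⟨C, hC⟩ := (isCompact_closedBall (1 : ℂ) (3 / 4)).exists_bound_of_continuousOn
    (f := fun ζ => b * ζ ^ (b - 1)) (continuousOn_const.mul fun ζ hζ =>
      (continuousAt_id.cpow continuousAt_const (hsl ζ hζ)).continuousWithinAt)
  have h1mem : (1 : ℂ) ∈ Metric.closedBall (1 : ℂ) (3 / 4) :=
    Metric.mem_closedBall_self (by norm_num)
  refine ⟨C, (norm_nonneg _).trans (hC 1 h1mem), fun ζ hζ => ?_⟩
  have := (convex_closedBall (1 : ℂ) (3 / 4)).norm_image_sub_le_of_norm_hasDerivWithin_le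
    (f := fun ζ => ζ ^ b) (f' := fun ζ => b * ζ ^ (b - 1)) (C := C)
    (fun x hx => by
      simpa using ((hasDerivAt_id x).cpow_const (c := b) (hsl x hx)).hasDerivWithinAt)
    hC h1mem (mem_closedBall_iff_norm.mpr hζ)
  simpa using this

lemma ofReal_mul_cpow {s : ℝ} (hs : 0 < s) (ζ b : ℂ) :
    ((s : ℂ) * ζ) ^ b = (s : ℂ) ^ b * ζ ^ b := by
  rcases eq_or_ne ζ 0 with rfl | hζ
  · rcases eq_or_ne b 0 with rfl | hb
    · simp
    · simp [hb]
  · have hs' : (s : ℂ) ≠ 0 := by exact_mod_cast hs.ne'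
    rw [Complex.cpow_def_of_ne_zero (mul_ne_zero hs' hζ), Complex.cpow_def_of_ne_zero hs',
      Complex.cpow_def_of_ne_zero hζ, Complex.log_ofReal_mul hs hζ, ← Complex.exp_add,
      Complex.ofReal_log hs.le]
    ring_nf

lemma eulerKernel_eq {a w : ℂ} {s : ℝ} (hs : 0 < s) (hs1 : s < 1) :
    eulerKernel a w s = (s : ℂ)⁻¹ * (1 - s + w * (1 - s) ^ 2 / s) ^ (-a) := by
  have hs' : (s : ℂ) ≠ 0 := by exact_mod_cast hs.ne'
  have e : (s : ℂ) * (1 - s + w * (1 - s) ^ 2 / s)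
      = ((1 - s : ℝ) : ℂ) * ((s : ℂ) + w * (1 - s)) := by
    push_cast; field_simp
  have h := congrArg (· ^ (-a)) e
  simp only [ofReal_mul_cpow hs, ofReal_mul_cpow (sub_pos.mpr hs1)] at h
  have hp : (s : ℂ) ^ (a - 1) * (s : ℂ) ^ (-a) = (s : ℂ)⁻¹ := by
    rw [← Complex.cpow_add _ _ hs', ← Complex.cpow_neg_one]; ring_nf
  rw [← hp, eulerKernel]
  push_cast at h
  linear_combination (-(s : ℂ) ^ (a - 1)) * h

open MeasureTheory in
lemma eulerKernel_middle (a : ℂ) :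
    ∃ C : ℝ, ∀ w : ℂ, w ≠ 0 → ‖w‖ ≤ 1 / 8 →
      IntervalIntegrable (eulerKernel a w) volume (2 * ‖w‖) (1 / 4) ∧
      ‖(∫ s in (2 * ‖w‖)..(1 / 4), eulerKernel a w s) - (Real.log (1 / 4 / (2 * ‖w‖)) : ℂ)‖
        ≤ C := by
  obtain ⟨C, hC0, hC⟩ := exists_norm_cpow_sub_one_le (-a)
  refine ⟨C, fun w hw hw8 => ?_⟩
  set r := ‖w‖ with hr
  have hr0 : 0 < r := norm_pos_iff.mpr hw
  have hr2 : 2 * r ≤ 1 / 4 := by linarith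
  have hmem : (0 : ℝ) ∉ Set.uIcc (2 * r) (1 / 4) := by
    rw [Set.uIcc_of_le hr2]; intro h; linarith [h.1]
  have hinv : IntervalIntegrable (fun s : ℝ => ((s⁻¹ : ℝ) : ℂ)) volume (2 * r) (1 / 4) :=
    ContinuousOn.intervalIntegrable (Complex.continuous_ofReal.comp_continuousOn
      (continuousOn_inv₀.mono fun x hx h => hmem ((show x = 0 from h) ▸ hx)))
  have hz : IntervalIntegrable (fun s : ℝ => s ^ (-2 : ℤ)) volume (2 * r) (1 / 4) :=
    intervalIntegral.intervalIntegrable_zpow (Or.inr hmem)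
  have hk : IntervalIntegrable (fun s : ℝ => C * (1 + r * s ^ (-2 : ℤ))) volume (2 * r) (1 / 4) :=
    (intervalIntegrable_const.add (hz.const_mul r)).const_mul C
  obtain ⟨hi, hle⟩ := intervalIntegrable_and_norm_integral_le
    (f := fun s => eulerKernel a w s - ((s⁻¹ : ℝ) : ℂ)) (p := 0) hr2
    ((measurable_eulerKernel a w).sub (by fun_prop)) hk (fun s hs hs4 _ => by
      have hs0 : 0 < s := by linarith
      rw [eulerKernel_eq hs0 (by linarith), Complex.ofReal_inv]
      set ζ : ℂ := 1 - s + w * (1 - s) ^ 2 / s with hζ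
      have e : (s : ℂ)⁻¹ * ζ ^ (-a) - (s : ℂ)⁻¹ = (s : ℂ)⁻¹ * (ζ ^ (-a) - 1) := by ring
      have n1 : ‖(1 : ℂ) - s‖ ≤ 1 := by
        rw [← Complex.ofReal_one, ← Complex.ofReal_sub, Complex.norm_of_nonneg] <;> linarith
      have hb : ‖ζ - 1‖ ≤ s + r / s := by
        have : ζ - 1 = w * (1 - s) ^ 2 / s - s := by rw [hζ]; ring
        rw [this]
        refine (norm_sub_le _ _).trans ?_
        rw [norm_div, norm_mul, norm_pow, Complex.norm_of_nonneg hs0.le, add_comm, ← hr]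
        gcongr
        have : ‖(1 : ℂ) - s‖ ^ 2 ≤ 1 := pow_le_one₀ (norm_nonneg _) n1
        nlinarith
      have hb2 : r / s ≤ 1 / 2 := by rw [div_le_iff₀ hs0]; linarith
      rw [e, norm_mul, norm_inv, Complex.norm_of_nonneg hs0.le]
      calc _ ≤ s⁻¹ * (C * (s + r / s)) := by
            gcongr
            exact (hC ζ (by linarith)).trans (by gcongr)
        _ = _ := by
            rw [zpow_neg]; norm_cast; field_simp)
  have hi' : IntervalIntegrable (eulerKernel a w) volume (2 * r) (1 / 4) := by
    have := hi.add hinv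
    refine this.congr fun s _ => by simp
  refine ⟨hi', ?_⟩
  rw [intervalIntegral.integral_sub hi' hinv, intervalIntegral.integral_ofReal,
    integral_inv_of_pos (by positivity) (by norm_num)] at hle
  refine hle.trans ?_
  rw [intervalIntegral.integral_const_mul, intervalIntegral.integral_add intervalIntegrable_const
    (hz.const_mul r), intervalIntegral.integral_const_mul, integral_zpow (Or.inr ⟨by norm_num, hmem⟩),
    intervalIntegral.integral_const]
  have : (1 / 4 - 2 * r) • (1 : ℝ) + r * (((1 / 4 : ℝ) ^ (-2 + 1 : ℤ) - (2 * r) ^ (-2 + 1 : ℤ)) /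
      (((-2 : ℤ) : ℝ) + 1)) = 3 / 4 - 6 * r := by
    norm_num
    field_simp
    ring
  rw [this]
  nlinarith

open MeasureTheory in
lemma eulerIntegral_add_log_bounded {a : ℂ} (h0 : 0 < a.re) (h1 : a.re < 1) :
    ∃ C : ℝ, ∀ w : ℂ, w ≠ 0 → ‖w‖ ≤ 1 / 8 →
      ‖(∫ s in (0:ℝ)..1, eulerKernel a w s) + Complex.log w‖ ≤ C := by
  obtain ⟨C₁, hC₁⟩ := eulerKernel_near h0 h1
  obtain ⟨C₂, hC₂⟩ := eulerKernel_middle a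
  obtain ⟨C₃, hC₃⟩ := eulerKernel_far h0 h1
  refine ⟨C₁ + C₂ + C₃ + (|Real.log (1 / 8)| + Real.pi), fun w hw hw8 => ?_⟩
  obtain ⟨i₁, b₁⟩ := hC₁ w hw hw8
  obtain ⟨i₂, b₂⟩ := hC₂ w hw hw8
  obtain ⟨i₃, b₃⟩ := hC₃ w hw8
  rw [← intervalIntegral.integral_add_adjacent_intervals (i₁.trans i₂) i₃,
    ← intervalIntegral.integral_add_adjacent_intervals i₁ i₂]
  have hr0 : 0 < ‖w‖ := norm_pos_iff.mpr hw
  have hlog : Real.log (1 / 4 / (2 * ‖w‖)) = Real.log (1 / 8) - Real.log ‖w‖ := by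
    rw [← Real.log_div (by norm_num) hr0.ne']
    congr 1; field_simp; norm_num
  rw [hlog] at b₂
  have hl : ‖(Real.log (1 / 8) : ℂ) + w.arg * Complex.I‖ ≤ |Real.log (1 / 8)| + Real.pi := by
    refine (norm_add_le _ _).trans ?_
    rw [norm_mul, Complex.norm_I, mul_one, Complex.norm_real, Complex.norm_real]
    exact add_le_add le_rfl (Complex.abs_arg_le_pi w)
  have hw' : Complex.log w = (Real.log ‖w‖ : ℂ) + w.arg * Complex.I := rfl
  rw [hw']
  refine le_trans (le_of_eq ?_) ((norm_add₃_le (a := ∫ s in (0:ℝ)..(2 * ‖w‖), eulerKernel a w s)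
    (b := (∫ s in (2 * ‖w‖)..(1 / 4), eulerKernel a w s) -
      ((Real.log (1 / 8) - Real.log ‖w‖ : ℝ) : ℂ))
    (c := (∫ s in (1 / 4 : ℝ)..1, eulerKernel a w s) +
      ((Real.log (1 / 8) : ℂ) + w.arg * Complex.I))).trans ?_)
  · congr 1; push_cast; ring
  · have := (norm_add_le (∫ s in (1 / 4 : ℝ)..1, eulerKernel a w s)
      ((Real.log (1 / 8) : ℂ) + w.arg * Complex.I))
    linarith

lemma Flam_two_eq (lam z : ℂ) :
    Flam 2 lam z = 1 / (Complex.Gamma (1/2 + lam) * Complex.Gamma (1/2 - lam)) *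
      ∫ s in (0:ℝ)..1, eulerKernel (1/2 + lam) (1 - z) s := by
  have h := intervalIntegral.integral_comp_sub_left (a := 0) (b := 1)
    (eulerKernel (1/2 + lam) (1 - z)) 1
  simp only [sub_zero, sub_self] at h
  rw [← h, Flam]
  congr 1
  · norm_num [Complex.Gamma_one, mul_comm]
  · refine intervalIntegral.integral_congr fun t _ => ?_
    simp only [eulerKernel]
    push_cast
    ring_nf

open Filter Topology in
theorem stmt13 (lam : ℂ) (hlam : admissible 2 lam) :
    Tendsto (fun z : ℂ => Flam 2 lam z / (-(Complex.log (1 - z)))) (𝓝[slitᶜ] 1)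
      (𝓝 (1 / (Complex.Gamma (1/2 + lam) * Complex.Gamma (1/2 - lam)))) := by
  have hre : 0 ≤ lam.re ∧ lam.re < 1 / 2 := by
    rcases hlam with ⟨h, _⟩ | ⟨_, h, h'⟩
    · constructor <;> linarith
    · norm_num at h'
      constructor <;> linarith
  have ha : (1 / 2 + lam).re = 1 / 2 + lam.re := by norm_num
  obtain ⟨C, hC⟩ := eulerIntegral_add_log_bounded (a := 1 / 2 + lam)
    (by rw [ha]; linarith [hre.1]) (by rw [ha]; linarith [hre.2])
  have hle : 𝓝[slitᶜ] (1 : ℂ) ≤ 𝓝[≠] 1 := by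
    refine nhdsWithin_mono _ fun z hz hz1 => hz ?_
    rw [Set.mem_singleton_iff] at hz1
    simp [slit, hz1]
  refine Tendsto.mono_left ?_ hle
  have hsub : Tendsto (fun z : ℂ => 1 - z) (𝓝[≠] 1) (𝓝[≠] 0) := by
    refine tendsto_nhdsWithin_iff.mpr ⟨?_, ?_⟩
    · refine tendsto_nhdsWithin_of_tendsto_nhds ?_
      have : Continuous fun z : ℂ => 1 - z := by fun_prop
      simpa using this.tendsto 1
    · filter_upwards [self_mem_nhdsWithin] with z hz
      exact sub_ne_zero.mpr (Ne.symm hz)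
  simp_rw [Flam_two_eq]
  suffices h : Tendsto (fun w : ℂ => (∫ s in (0:ℝ)..1, eulerKernel (1/2 + lam) w s) /
      (-(Complex.log w))) (𝓝[≠] 0) (𝓝 1) by
    simpa [mul_div_assoc] using (h.comp hsub).const_mul
      (1 / (Complex.Gamma (1/2 + lam) * Complex.Gamma (1/2 - lam)))
  have hnorm : Tendsto (fun w : ℂ => ‖w‖) (𝓝[≠] 0) (𝓝[>] 0) := tendsto_norm_nhdsNE_zero
  have hlog : Tendsto (fun w : ℂ => ‖Complex.log w‖) (𝓝[≠] 0) atTop := by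
    refine tendsto_atTop_mono (fun w => ?_)
      (tendsto_neg_atBot_atTop.comp (Real.tendsto_log_nhdsGT_zero.comp hnorm))
    have := (neg_le_abs _).trans (Complex.abs_re_le_norm (Complex.log w))
    simpa [Complex.log_re] using this
  have hsmall : ∀ᶠ w : ℂ in 𝓝[≠] 0, ‖w‖ ≤ 1 / 8 :=
    (tendsto_nhdsWithin_iff.mp hnorm).1.eventually (Iic_mem_nhds (by norm_num))
  rw [tendsto_iff_norm_sub_tendsto_zero]
  refine squeeze_zero' (.of_forall fun _ => norm_nonneg _) ?_
    (Tendsto.const_div_atTop hlog C)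
  filter_upwards [hsmall, self_mem_nhdsWithin, hlog.eventually_gt_atTop 0] with w hw hw0 hl
  have hl0 : Complex.log w ≠ 0 := norm_pos_iff.mp hl
  have e : (∫ s in (0:ℝ)..1, eulerKernel (1/2 + lam) w s) / (-(Complex.log w)) - 1 =
      -(((∫ s in (0:ℝ)..1, eulerKernel (1/2 + lam) w s) + Complex.log w) / Complex.log w) := by
    field_simp
    ring
  rw [e, norm_neg, norm_div]
  gcongr
  exact hC w hw0 hw
end
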